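/- arXiv:1407.4174 — 4 statements merged into one kernel-verified Lean document; each statement's English description precedes it below -/
import Mathlib

section
/- Let Γ = (V, 𝓑, μ, A, E) be an h-layered commutative measure graph with layers V_0 ⊔ ⋯ ⊔ V_h, fix C > 0 and let w be the weight corresponding to C. Then for every ε > 0 there exists an ε-minimal cutset S ∈ 𝓑 with S ⊆ V_0 ⊔ V_h. -/
open MeasureTheory ENNReal

variable {V A : Type*}

/-- `Im_a^+(W)`: the set of heads of `a`-labelled edges whose tail lies in `W`. -/
def ImaPos (E : Set (V × V × A)) (a : A) (W : Set V) : Set V :=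
  {v | ∃ w ∈ W, (w, v, a) ∈ E}

/-- `Im_a^-(W)`: the set of tails of `a`-labelled edges whose head lies in `W`. -/
def ImaNeg (E : Set (V × V × A)) (a : A) (W : Set V) : Set V :=
  {v | ∃ w ∈ W, (v, w, a) ∈ E}

/-- `Im^+(W) = ⋃_{a ∈ A} Im_a^+(W)`. -/
def ImPos (E : Set (V × V × A)) (W : Set V) : Set V := ⋃ a : A, ImaPos E a W

/-- The `n`-fold image `Im^n(W)`. -/
def ImIter (E : Set (V × V × A)) (n : ℕ) (W : Set V) : Set V := (ImPos E)^[n] W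

/-- `L_a^+`: vertices with an outgoing `a`-labelled edge. -/
def LaPos (E : Set (V × V × A)) (a : A) : Set V := {x | ∃ y, (x, y, a) ∈ E}

/-- `L_a^-`: vertices with an incoming `a`-labelled edge. -/
def LaNeg (E : Set (V × V × A)) (a : A) : Set V := {x | ∃ y, (y, x, a) ∈ E}

/-- A measure graph structure: `(V, 𝓑, μ)` is a finite measure space, `A` is a finite
label set, and `E ⊆ V × V × A` is an edge set such that the sets `L_a^±` are measurable,
the maps `Im_a^±` preserve measurability and measure, and each vertex has at most one
outgoing and at most one incoming `a`-labelled edge for each label `a`. -/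
structure IsMeasureGraph [MeasurableSpace V] (μ : Measure V) [Fintype A]
    (E : Set (V × V × A)) : Prop where
  finiteMeasure : μ Set.univ ≠ ⊤
  measLaPos : ∀ a : A, MeasurableSet (LaPos E a)
  measLaNeg : ∀ a : A, MeasurableSet (LaNeg E a)
  measImaPos : ∀ (a : A) (W : Set V), MeasurableSet W → W ⊆ LaPos E a →
    MeasurableSet (ImaPos E a W) ∧ μ (ImaPos E a W) = μ W
  measImaNeg : ∀ (a : A) (W : Set V), MeasurableSet W → W ⊆ LaNeg E a →
    MeasurableSet (ImaNeg E a W) ∧ μ (ImaNeg E a W) = μ W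
  uniqueOut : ∀ (a : A) (x y y' : V), (x, y, a) ∈ E → (x, y', a) ∈ E → y = y'
  uniqueIn : ∀ (a : A) (x x' y : V), (x, y, a) ∈ E → (x', y, a) ∈ E → x = x'

/-- `E^+(v)`: the set of edges with tail `v`. -/
def EdgesFrom (E : Set (V × V × A)) (v : V) : Set (V × V × A) := {e ∈ E | e.1 = v}

/-- A labelled directed graph is semi-commutative if for every edge `(x, y, a)` there is
an injection `φ : E^+(y) → E^+(x)` such that `(head (φ e), head e, a)` is an edge for
every `e ∈ E^+(y)`. -/
def IsSemiCommutative (E : Set (V × V × A)) : Prop :=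
  ∀ x y a, (x, y, a) ∈ E →
    ∃ φ : EdgesFrom E y → EdgesFrom E x, Function.Injective φ ∧
      ∀ e : EdgesFrom E y, ((φ e : V × V × A).2.1, (e : V × V × A).2.1, a) ∈ E

/-- The dual (edge-reversed) edge set. -/
def dualEdges (E : Set (V × V × A)) : Set (V × V × A) := {e | (e.2.1, e.1, e.2.2) ∈ E}

/-- A graph is commutative (Plünnecke) if both it and its dual are semi-commutative. -/
def IsCommutativeGraph (E : Set (V × V × A)) : Prop :=
  IsSemiCommutative E ∧ IsSemiCommutative (dualEdges E)

/-- `L` is an `h`-layering of the graph: the layers `L 0, …, L h` are measurable, pairwise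
disjoint and partition `V`, and every edge goes from some layer `L i` to `L (i+1)` with
`i < h`. -/
def IsLayering [MeasurableSpace V] (E : Set (V × V × A)) (h : ℕ) (L : ℕ → Set V) : Prop :=
  (∀ i, MeasurableSet (L i)) ∧
  (Set.univ : Set V) = (⋃ i ∈ Finset.range (h + 1), L i) ∧
  (∀ i j, i ≠ j → Disjoint (L i) (L j)) ∧
  (∀ x y a, (x, y, a) ∈ E → ∃ i < h, x ∈ L i ∧ y ∈ L (i + 1))

/-- The magnification ratio of order `j`:
`D_j = inf { μ(Im^j Y) / μ(Y) : Y ⊆ V_0 measurable, μ(Y) > 0 }`. -/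
noncomputable def magD [MeasurableSpace V] (μ : Measure V) (E : Set (V × V × A))
    (L : ℕ → Set V) (j : ℕ) : ℝ≥0∞ :=
  sInf {r : ℝ≥0∞ | ∃ Y : Set V, Y ⊆ L 0 ∧ MeasurableSet Y ∧ 0 < μ Y ∧
    r = μ (ImIter E j Y) / μ Y}

/-- The weight corresponding to `C`: `w(S) = ∑_{j=0}^h C^{-j} μ(S ∩ V_j)`. -/
noncomputable def graphWeight [MeasurableSpace V] (μ : Measure V) (L : ℕ → Set V)
    (h : ℕ) (C : ℝ≥0∞) (S : Set V) : ℝ≥0∞ :=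
  ∑ j ∈ Finset.range (h + 1), C⁻¹ ^ j * μ (S ∩ L j)

/-- `S` is a cutset: every directed path from `V_0` to `V_h` meets `S`. -/
def IsCutset (E : Set (V × V × A)) (h : ℕ) (L : ℕ → Set V) (S : Set V) : Prop :=
  ∀ p : ℕ → V, p 0 ∈ L 0 → p h ∈ L h →
    (∀ i < h, ∃ a, (p i, p (i + 1), a) ∈ E) → ∃ i ≤ h, p i ∈ S

/-- `S` is an `ε`-minimal cutset (with respect to the weight corresponding to `C`):
`S` is a measurable cutset with `w(S) ≤ inf { w(Y) : Y a measurable cutset } + ε`. -/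
def IsEpsMinCutset [MeasurableSpace V] (μ : Measure V) (E : Set (V × V × A)) (h : ℕ)
    (L : ℕ → Set V) (C ε : ℝ≥0∞) (S : Set V) : Prop :=
  MeasurableSet S ∧ IsCutset E h L S ∧
    graphWeight μ L h C S ≤
      sInf {w : ℝ≥0∞ | ∃ Y : Set V, MeasurableSet Y ∧ IsCutset E h L Y ∧
        w = graphWeight μ L h C Y} + ε

section Helpers

open Classical in
/-- number of labels of edges from `x` into `M`. -/
noncomputable def outDeg [Fintype A] (E : Set (V × V × A)) (M : Set V) (x : V) : ℕ :=
  (Finset.univ.filter (fun a : A => x ∈ ImaNeg E a M)).card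

/-- vertices of `P` with at least `k` edges into `M`. -/
def lev [Fintype A] (E : Set (V × V × A)) (P M : Set V) (k : ℕ) : Set V :=
  {x | x ∈ P ∧ k ≤ outDeg E M x}

/-- vertices reached from `B` in `n` steps avoiding `S`. -/
def reach (E : Set (V × V × A)) (S B : Set V) : ℕ → Set V
  | 0 => B \ S
  | n + 1 => ImPos E (reach E S B n) \ S

theorem mem_dual {E : Set (V × V × A)} {x y : V} {a : A} :
    (x, y, a) ∈ dualEdges E ↔ (y, x, a) ∈ E := Iff.rfl

theorem dual_dual (E : Set (V × V × A)) : dualEdges (dualEdges E) = E := rfl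

theorem IsMeasureGraph.dual [MeasurableSpace V] {μ : Measure V} [Fintype A]
    {E : Set (V × V × A)} (hG : IsMeasureGraph μ E) : IsMeasureGraph μ (dualEdges E) where
  finiteMeasure := hG.finiteMeasure
  measLaPos := hG.measLaNeg
  measLaNeg := hG.measLaPos
  measImaPos := hG.measImaNeg
  measImaNeg := hG.measImaPos
  uniqueOut := fun a x y y' h1 h2 => hG.uniqueIn a y y' x h1 h2
  uniqueIn := fun a x x' y h1 h2 => hG.uniqueOut a y x x' h1 h2

theorem meas_ImaNeg [MeasurableSpace V] {μ : Measure V} [Fintype A]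
    {E : Set (V × V × A)} (hG : IsMeasureGraph μ E) (a : A) {M : Set V}
    (hM : MeasurableSet M) : MeasurableSet (ImaNeg E a M) := by
  have := (hG.measImaNeg a (M ∩ LaNeg E a) (hM.inter (hG.measLaNeg a))
    Set.inter_subset_right).1
  convert this using 1
  ext x
  constructor
  · rintro ⟨y, hy, he⟩
    exact ⟨y, ⟨hy, x, he⟩, he⟩
  · rintro ⟨y, hy, he⟩
    exact ⟨y, hy.1, he⟩

theorem meas_ImPos [MeasurableSpace V] {μ : Measure V} [Fintype A]
    {E : Set (V × V × A)} (hG : IsMeasureGraph μ E) {M : Set V}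
    (hM : MeasurableSet M) : MeasurableSet (ImPos E M) :=
  MeasurableSet.iUnion fun a => meas_ImaNeg hG.dual a hM

theorem meas_reach [MeasurableSpace V] {μ : Measure V} [Fintype A]
    {E : Set (V × V × A)} (hG : IsMeasureGraph μ E) {S B : Set V}
    (hS : MeasurableSet S) (hB : MeasurableSet B) (n : ℕ) :
    MeasurableSet (reach E S B n) := by
  induction n with
  | zero => exact hB.diff hS
  | succ n ih => exact (meas_ImPos hG ih).diff hS

theorem swap_meas [MeasurableSpace V] {μ : Measure V} [Fintype A]
    {E : Set (V × V × A)} (hG : IsMeasureGraph μ E) (a : A) {P M : Set V}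
    (hP : MeasurableSet P) (hM : MeasurableSet M) :
    μ (P ∩ ImaNeg E a M) = μ (M ∩ ImaNeg (dualEdges E) a P) := by
  have h1 := (hG.measImaPos a (P ∩ ImaNeg E a M) (hP.inter (meas_ImaNeg hG a hM)) (by
    rintro x ⟨_, y, _, he⟩
    exact ⟨y, he⟩)).2
  rw [← h1]
  congr 1
  ext y
  constructor
  · rintro ⟨x, ⟨hx, y', hy', he'⟩, he⟩
    obtain rfl := hG.uniqueOut a x y y' he he'
    exact ⟨hy', x, hx, he⟩
  · rintro ⟨hy, x, hx, he⟩
    exact ⟨x, ⟨hx, y, hy, he⟩, he⟩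

open Classical in
theorem outDeg_eq_sum [Fintype A] (E : Set (V × V × A)) (M : Set V) (x : V) :
    (outDeg E M x : ℝ≥0∞) = ∑ a : A, (ImaNeg E a M).indicator 1 x := by
  simp [outDeg, Set.indicator_apply, Finset.sum_boole]

theorem outDeg_le [Fintype A] (E : Set (V × V × A)) (M : Set V) (x : V) :
    outDeg E M x ≤ Fintype.card A := Finset.card_le_univ _

theorem meas_outDeg [MeasurableSpace V] {μ : Measure V} [Fintype A]
    {E : Set (V × V × A)} (hG : IsMeasureGraph μ E) {M : Set V} (hM : MeasurableSet M) :
    Measurable (fun x => (outDeg E M x : ℝ≥0∞)) := by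
  simp only [outDeg_eq_sum]
  exact Finset.measurable_fun_sum _ fun a _ =>
    measurable_one.indicator (meas_ImaNeg hG a hM)

theorem meas_lev [MeasurableSpace V] {μ : Measure V} [Fintype A]
    {E : Set (V × V × A)} (hG : IsMeasureGraph μ E) {P M : Set V} (hP : MeasurableSet P)
    (hM : MeasurableSet M) (k : ℕ) : MeasurableSet (lev E P M k) := by
  have : MeasurableSet {x | (k : ℝ≥0∞) ≤ (outDeg E M x : ℝ≥0∞)} :=
    measurableSet_le measurable_const (meas_outDeg hG hM)
  simp only [Nat.cast_le] at this
  exact hP.inter this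

theorem sum_lev [MeasurableSpace V] {μ : Measure V} [Fintype A]
    {E : Set (V × V × A)} (hG : IsMeasureGraph μ E) {P M : Set V} (hP : MeasurableSet P)
    (hM : MeasurableSet M) :
    ∑ k ∈ Finset.range (Fintype.card A + 1), μ (lev E P M (k + 1)) =
      ∑ a : A, μ (P ∩ ImaNeg E a M) := by
  have e1 : ∀ k, μ (lev E P M (k + 1)) =
      ∫⁻ x in P, {x | k + 1 ≤ outDeg E M x}.indicator 1 x ∂μ := by
    intro k
    have hm : MeasurableSet {x | k + 1 ≤ outDeg E M x} := by
      have := meas_lev hG MeasurableSet.univ hM (k + 1)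
      simpa [lev] using this
    rw [lintegral_indicator_one hm, Measure.restrict_apply hm, Set.inter_comm]
    rfl
  have e2 : ∀ a : A, μ (P ∩ ImaNeg E a M) =
      ∫⁻ x in P, (ImaNeg E a M).indicator 1 x ∂μ := by
    intro a
    have hm := meas_ImaNeg hG a hM
    rw [lintegral_indicator_one hm, Measure.restrict_apply hm, Set.inter_comm]
  simp only [e1, e2]
  rw [← lintegral_finsetSum, ← lintegral_finsetSum]
  · congr 1
    ext x
    rw [← outDeg_eq_sum]
    have hle := outDeg_le E M x
    simp only [Set.indicator_apply, Set.mem_ofPred_eq, Pi.one_apply, Finset.sum_boole]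
    congr 1
    have : (Finset.range (Fintype.card A + 1)).filter (fun k => k + 1 ≤ outDeg E M x)
        = Finset.range (outDeg E M x) := by
      ext k
      simp only [Finset.mem_filter, Finset.mem_range]
      omega
    rw [this, Finset.card_range]
  · intro a _
    exact measurable_one.indicator (meas_ImaNeg hG a hM)
  · intro k _
    refine measurable_one.indicator ?_
    have := meas_lev hG MeasurableSet.univ hM (k + 1)
    simpa [lev] using this

theorem sum_lev_swap [MeasurableSpace V] {μ : Measure V} [Fintype A]
    {E : Set (V × V × A)} (hG : IsMeasureGraph μ E) {P M : Set V} (hP : MeasurableSet P)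
    (hM : MeasurableSet M) :
    ∑ k ∈ Finset.range (Fintype.card A + 1), μ (lev E P M (k + 1)) =
    ∑ k ∈ Finset.range (Fintype.card A + 1), μ (lev (dualEdges E) M P (k + 1)) := by
  rw [sum_lev hG hP hM, sum_lev hG.dual hM hP]
  exact Finset.sum_congr rfl fun a _ => swap_meas hG a hP hM

theorem edge_form {E : Set (V × V × A)} {e : V × V × A} {x : V} (he : e ∈ E) (hx : e.1 = x) :
    (x, e.2.1, e.2.2) ∈ E := by
  subst hx
  exact he

theorem outDeg_mono [Fintype A] {E : Set (V × V × A)} 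
    (hout : ∀ (a : A) (x y y' : V), (x, y, a) ∈ E → (x, y', a) ∈ E → y = y')
    (hS : IsSemiCommutative E) {R M Q : Set V}
    (H : ∀ x y z a b, x ∈ R → z ∈ Q → (x, y, a) ∈ E → (y, z, b) ∈ E → y ∈ M)
    {x y : V} {a : A} (hx : x ∈ R) (he : (x, y, a) ∈ E) :
    outDeg E Q y ≤ outDeg E M x := by
  classical
  obtain ⟨φ, hφ, hφ'⟩ := hS x y a he
  have key : ∀ b : {b : A // y ∈ ImaNeg E b Q}, ∃ e : EdgesFrom E y,
      (e : V × V × A).2.2 = b ∧ (e : V × V × A).2.1 ∈ Q := by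
    rintro ⟨b, z, hz, hb⟩
    exact ⟨⟨(y, z, b), hb, rfl⟩, rfl, hz⟩
  choose e he1 he2 using key
  have hx' : ∀ b, x ∈ ImaNeg E (φ (e b) : V × V × A).2.2 M := by
    intro b
    have h1 := hφ' (e b)
    have h2 := (φ (e b)).2
    obtain ⟨h3, h4⟩ := h2
    have h5 : (x, (φ (e b) : V × V × A).2.1, (φ (e b) : V × V × A).2.2) ∈ E := edge_form h3 h4
    exact ⟨_, H _ _ _ _ _ hx (he2 b) h5 h1, h5⟩
  have : Fintype.card {b : A // y ∈ ImaNeg E b Q} ≤ Fintype.card {b : A // x ∈ ImaNeg E b M} := by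
    refine Fintype.card_le_of_injective (fun b => ⟨_, hx' b⟩) ?_
    intro b b' hbb
    have hl : (φ (e b) : V × V × A).2.2 = (φ (e b') : V × V × A).2.2 := congrArg Subtype.val hbb
    obtain ⟨h3, h4⟩ := (φ (e b)).2
    obtain ⟨h3', h4'⟩ := (φ (e b')).2
    have h6 : φ (e b) = φ (e b') := by
      apply Subtype.ext
      refine Prod.ext (h4.trans h4'.symm) (Prod.ext ?_ hl)
      refine hout (φ (e b) : V × V × A).2.2 x _ _ ?_ ?_
      · exact edge_form h3 h4
      · rw [hl]; exact edge_form h3' h4'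
    have h7 := hφ h6
    apply Subtype.ext
    rw [← he1 b, ← he1 b', h7]
  simpa [outDeg, Fintype.card_subtype] using this

theorem reach_of_path {E : Set (V × V × A)} {S B : Set V} (p : ℕ → V) (n : ℕ)
    (h0 : p 0 ∈ B) (hS : ∀ i ≤ n, p i ∉ S) (hp : ∀ i < n, ∃ a, (p i, p (i + 1), a) ∈ E) :
    p n ∈ reach E S B n := by
  induction n with
  | zero => exact ⟨h0, hS 0 le_rfl⟩
  | succ n ih =>
    obtain ⟨a, ha⟩ := hp n (by omega)
    refine ⟨Set.mem_iUnion.2 ⟨a, p n, ih (fun i hi => hS i (by omega))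
      (fun i hi => hp i (by omega)), ha⟩, hS _ le_rfl⟩

theorem path_of_reach {E : Set (V × V × A)} {S B : Set V} (n : ℕ) (x : V)
    (hx : x ∈ reach E S B n) : ∃ p : ℕ → V, p n = x ∧ p 0 ∈ B ∧ (∀ i ≤ n, p i ∉ S) ∧
      (∀ i < n, ∃ a, (p i, p (i + 1), a) ∈ E) := by
  induction n generalizing x with
  | zero => exact ⟨fun _ => x, rfl, hx.1, fun _ _ => hx.2, by simp⟩
  | succ n ih =>
    obtain ⟨h1, h2⟩ := hx
    obtain ⟨a, y, hy, he⟩ := Set.mem_iUnion.1 h1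
    obtain ⟨p, p1, p2, p3, p4⟩ := ih y hy
    refine ⟨fun i => if i ≤ n then p i else x, by simp, by simpa using p2, ?_, ?_⟩
    · intro i hi
      by_cases h : i ≤ n
      · simpa [h] using p3 i h
      · simpa [h] using h2
    · intro i hi
      by_cases h : i = n
      · subst h
        refine ⟨a, ?_⟩
        simpa [p1] using he
      · have h3 : i ≤ n := by omega
        have h4 : i + 1 ≤ n := by omega
        simpa [h3, h4] using p4 i (by omega)

theorem reach_glue {E : Set (V × V × A)} {S B B' : Set V} (m n : ℕ) (x : V)
    (hx : x ∈ reach E S B m) (hx' : x ∈ reach (dualEdges E) S B' n) :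
    ∃ z ∈ B', z ∈ reach E S B (m + n) := by
  induction n generalizing m x with
  | zero => exact ⟨x, hx'.1, hx⟩
  | succ n ih =>
    obtain ⟨h1, h2⟩ := hx'
    obtain ⟨a, y, hy, he⟩ := Set.mem_iUnion.1 h1
    have hyS : y ∉ S := by
      cases n with
      | zero => exact hy.2
      | succ n => exact hy.2
    have := ih (m + 1) y ⟨Set.mem_iUnion.2 ⟨a, x, hx, he⟩, hyS⟩ hy
    rwa [show m + (n + 1) = m + 1 + n by omega]

theorem layer_unique [MeasurableSpace V] {E : Set (V × V × A)} {h : ℕ} {L : ℕ → Set V}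
    (hL : IsLayering E h L) {x : V} {i j : ℕ} (hi : x ∈ L i) (hj : x ∈ L j) : i = j := by
  by_contra hne
  exact Set.disjoint_left.1 (hL.2.2.1 i j hne) hi hj

theorem layer_succ [MeasurableSpace V] {E : Set (V × V × A)} {h : ℕ} {L : ℕ → Set V}
    (hL : IsLayering E h L) {x y : V} {a : A} {i : ℕ} (hi : x ∈ L i) (he : (x, y, a) ∈ E) :
    y ∈ L (i + 1) := by
  obtain ⟨j, _, hx, hy⟩ := hL.2.2.2 x y a he
  rwa [layer_unique hL hi hx]

theorem layer_pred [MeasurableSpace V] {E : Set (V × V × A)} {h : ℕ} {L : ℕ → Set V}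
    (hL : IsLayering E h L) {x y : V} {a : A} {i : ℕ} (hi : y ∈ L (i + 1)) (he : (x, y, a) ∈ E) :
    x ∈ L i := by
  obtain ⟨j, _, hx, hy⟩ := hL.2.2.2 x y a he
  have := layer_unique hL hi hy
  rwa [show i = j by omega]

theorem reach_layer [MeasurableSpace V] {E : Set (V × V × A)} {h : ℕ} {L : ℕ → Set V}
    (hL : IsLayering E h L) (S : Set V) (n : ℕ) : reach E S (L 0) n ⊆ L n := by
  induction n with
  | zero => exact fun x hx => hx.1
  | succ n ih =>
    rintro x ⟨h1, _⟩
    obtain ⟨a, y, hy, he⟩ := Set.mem_iUnion.1 h1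
    exact layer_succ hL (ih hy) he

theorem reach_layer_dual [MeasurableSpace V] {E : Set (V × V × A)} {h : ℕ} {L : ℕ → Set V}
    (hL : IsLayering E h L) (S : Set V) (n m : ℕ) (hm : m + n = h) :
    reach (dualEdges E) S (L h) n ⊆ L m := by
  induction n generalizing m with
  | zero => 
    obtain rfl : m = h := by omega
    exact fun x hx => hx.1
  | succ n ih =>
    rintro x ⟨h1, _⟩
    obtain ⟨a, y, hy, he⟩ := Set.mem_iUnion.1 h1
    exact layer_pred hL (ih (m + 1) (by omega) hy) he

/-- Vertices between the reachable and the co-reachable part lie in the cutset. -/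
theorem mid_mem [MeasurableSpace V] {E : Set (V × V × A)} {h : ℕ} {L : ℕ → Set V}
    (hL : IsLayering E h L) {S : Set V} (hS : IsCutset E h L S) (i r : ℕ) (hr : i + 2 + r = h)
    (x y z : V) (a b : A) (hx : x ∈ reach E S (L 0) i)
    (hz : z ∈ reach (dualEdges E) S (L h) r) (h1 : (x, y, a) ∈ E) (h2 : (y, z, b) ∈ E) :
    y ∈ S ∩ L (i + 1) := by
  refine ⟨?_, layer_succ hL (reach_layer hL S i hx) h1⟩
  by_contra hy
  have hyR : y ∈ reach E S (L 0) (i + 1) := ⟨Set.mem_iUnion.2 ⟨a, x, hx, h1⟩, hy⟩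
  have hyQ : y ∈ reach (dualEdges E) S (L h) (r + 1) := ⟨Set.mem_iUnion.2 ⟨b, z, hz, h2⟩, hy⟩
  obtain ⟨t, ht, ht'⟩ := reach_glue _ _ y hyR hyQ
  rw [show i + 1 + (r + 1) = h by omega] at ht'
  obtain ⟨p, p1, p2, p3, p4⟩ := path_of_reach _ _ ht'
  obtain ⟨k, hk, hk'⟩ := hS p p2 (p1 ▸ ht) p4
  exact p3 k hk hk'

theorem path_layer [MeasurableSpace V] {E : Set (V × V × A)} {h : ℕ} {L : ℕ → Set V}
    (hL : IsLayering E h L) (p : ℕ → V) (h0 : p 0 ∈ L 0)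
    (hp : ∀ i < h, ∃ a, (p i, p (i + 1), a) ∈ E) (i : ℕ) (hi : i ≤ h) : p i ∈ L i := by
  induction i with
  | zero => exact h0
  | succ i ih =>
    obtain ⟨a, ha⟩ := hp i (by omega)
    exact layer_succ hL (ih (by omega)) ha

theorem replace_cutset [MeasurableSpace V] {E : Set (V × V × A)} {h : ℕ} {L : ℕ → Set V}
    (hL : IsLayering E h L) {S : Set V} (hS : IsCutset E h L S) (i r : ℕ) (hr : i + 2 + r = h)
    (T Z : Set V) (hT : T ⊆ S ∩ L (i + 1))
    (hZ : ∀ x y z a b, x ∈ reach E S (L 0) i → y ∈ T →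
      z ∈ reach (dualEdges E) S (L h) r → (x, y, a) ∈ E → (y, z, b) ∈ E → x ∈ Z ∨ z ∈ Z) :
    IsCutset E h L (S \ T ∪ Z) := by
  intro p p0 ph pe
  by_contra hcon
  push Not at hcon
  have hlay := path_layer hL p p0 pe
  have hST : ∀ k ≤ h, p k ∈ S → k = i + 1 ∧ p k ∈ T := by
    intro k hk hkS
    have hkT : p k ∈ T := by
      by_contra hkT
      exact hcon k hk (Or.inl ⟨hkS, hkT⟩)
    exact ⟨layer_unique hL (hlay k hk) (hT hkT).2, hkT⟩
  obtain ⟨k, hk, hkS⟩ := hS p p0 ph pe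
  obtain ⟨rfl, hkT⟩ := hST k hk hkS
  have hR : p i ∈ reach E S (L 0) i := by
    refine reach_of_path p i p0 (fun l hl hlS => ?_) (fun l hl => pe l (by omega))
    have := (hST l (by omega) hlS).1
    omega
  have hQ : p (i + 2) ∈ reach (dualEdges E) S (L h) r := by
    have := reach_of_path (E := dualEdges E) (S := S) (B := L h) (fun l => p (h - l)) r
      (by simpa using ph) (fun l hl hlS => by
        have := (hST (h - l) (by omega) hlS).1
        omega) (fun l hl => by
        obtain ⟨a, ha⟩ := pe (h - (l + 1)) (by omega)
        rw [show h - (l + 1) + 1 = h - l by omega] at ha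
        exact ⟨a, ha⟩)
    simpa [show h - r = i + 2 by omega] using this
  obtain ⟨a, ha⟩ := pe i (by omega)
  obtain ⟨b, hb⟩ := pe (i + 1) (by omega)
  rcases hZ _ _ _ a b hR hkT hQ ha hb with h1 | h1
  · exact hcon i (by omega) (Or.inr h1)
  · exact hcon (i + 2) (by omega) (Or.inr h1)

theorem replace_weight [MeasurableSpace V] (μ : Measure V) {E : Set (V × V × A)} {h : ℕ}
    {L : ℕ → Set V} (hL : IsLayering E h L) (C : ℝ≥0∞) {S T Z : Set V} (hS : MeasurableSet S)
    (hT : MeasurableSet T) (hZ : MeasurableSet Z) (j m : ℕ) (hj : j ≤ h) (hm : m ≤ h)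
    (hTS : T ⊆ S ∩ L j) (hZm : Z ⊆ L m) :
    graphWeight μ L h C (S \ T ∪ Z) + C⁻¹ ^ j * μ T ≤ graphWeight μ L h C S + C⁻¹ ^ m * μ Z := by
  let W : Measure V := ∑ j ∈ Finset.range (h + 1), C⁻¹ ^ j • μ.restrict (L j)
  have hW : ∀ X, MeasurableSet X → graphWeight μ L h C X = W X := by
    intro X hX
    simp [W, graphWeight, Measure.restrict_apply hX]
  have hW1 : ∀ X k, k ≤ h → MeasurableSet X → X ⊆ L k → W X = C⁻¹ ^ k * μ X := by
    intro X k hk hX hXk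
    rw [← hW X hX, graphWeight, Finset.sum_eq_single k]
    · rw [Set.inter_eq_left.2 hXk]
    · intro b _ hb
      have : X ∩ L b = ∅ := by
        ext x
        simp only [Set.mem_inter_iff, Set.mem_empty_iff_false, iff_false, not_and]
        exact fun h1 h2 => hb (layer_unique hL h2 (hXk h1))
      simp [this]
    · intro hk'
      simp at hk'
      omega
  rw [hW _ ((hS.diff hT).union hZ), hW _ hS,
    ← hW1 T j hj hT (hTS.trans Set.inter_subset_right), ← hW1 Z m hm hZ hZm]
  calc W (S \ T ∪ Z) + W T ≤ W (S \ T) + W Z + W T := by gcongr; exact measure_union_le _ _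
    _ = W (S \ T) + W T + W Z := by ring
    _ = W S + W Z := by
      have h5 := measure_sdiff_add_inter (μ := W) S hT
      rw [Set.inter_eq_right.2 (hTS.trans Set.inter_subset_left)] at h5
      rw [h5]

theorem arith_step (N : ℕ) (C c δ : ℝ≥0∞) (i : ℕ) (hCc : C * c = 1) (hc : c ≠ ⊤)
    (X T U Y : ℕ → ℝ≥0∞) (hX : ∀ k, X k ≠ ⊤)
    (h1 : ∀ k, c ^ (i + 1) * T k ≤ c ^ i * X k + δ)
    (h2 : ∀ k, c ^ (i + 1) * U k ≤ c ^ (i + 2) * Y k + δ)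
    (hXU : ∑ k ∈ Finset.range (N + 1), X k = ∑ k ∈ Finset.range (N + 1), U k)
    (hYT : ∑ k ∈ Finset.range (N + 1), T k = ∑ k ∈ Finset.range (N + 1), Y k) :
    c ^ i * X 0 ≤ c ^ (i + 1) * T 0 + (N + C * (N + 1)) * δ := by
  have e2 : c ^ (i + 1) * ∑ k ∈ Finset.range (N + 1), U k ≤
      c ^ (i + 2) * ∑ k ∈ Finset.range (N + 1), Y k + (N + 1) * δ := by
    calc _ ≤ ∑ k ∈ Finset.range (N + 1), (c ^ (i + 2) * Y k + δ) := by
          rw [Finset.mul_sum]; exact Finset.sum_le_sum fun k _ => h2 k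
      _ = _ := by rw [Finset.sum_add_distrib, Finset.mul_sum]; simp
  rw [← hXU, ← hYT] at e2
  have e3 : c ^ i * ∑ k ∈ Finset.range (N + 1), X k ≤
      c ^ (i + 1) * ∑ k ∈ Finset.range (N + 1), T k + C * (N + 1) * δ := by
    calc c ^ i * ∑ k ∈ Finset.range (N + 1), X k
        = C * c * (c ^ i * ∑ k ∈ Finset.range (N + 1), X k) := by rw [hCc, one_mul]
      _ = C * (c ^ (i + 1) * ∑ k ∈ Finset.range (N + 1), X k) := by ring
      _ ≤ C * (c ^ (i + 2) * ∑ k ∈ Finset.range (N + 1), T k + (N + 1) * δ) := by gcongr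
      _ = C * c * (c ^ (i + 1) * ∑ k ∈ Finset.range (N + 1), T k) + C * (N + 1) * δ := by ring
      _ = _ := by rw [hCc, one_mul]
  rw [Finset.sum_range_succ', Finset.sum_range_succ', mul_add, mul_add] at e3
  have e1 : c ^ (i + 1) * ∑ k ∈ Finset.range N, T (k + 1) ≤
      c ^ i * ∑ k ∈ Finset.range N, X (k + 1) + N * δ := by
    calc _ ≤ ∑ k ∈ Finset.range N, (c ^ i * X (k + 1) + δ) := by
          rw [Finset.mul_sum]; exact Finset.sum_le_sum fun k _ => h1 (k + 1)
      _ = _ := by rw [Finset.sum_add_distrib, Finset.mul_sum]; simp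
  have hfin : c ^ i * ∑ k ∈ Finset.range N, X (k + 1) ≠ ⊤ :=
    ENNReal.mul_ne_top (ENNReal.pow_ne_top hc) (ENNReal.sum_ne_top.2 fun k _ => hX _)
  refine (ENNReal.add_le_add_iff_left hfin).1 ?_
  calc _ ≤ _ := e3
    _ ≤ (c ^ i * ∑ k ∈ Finset.range N, X (k + 1) + N * δ) + c ^ (i + 1) * T 0
        + C * (N + 1) * δ := by gcongr
    _ = _ := by ring

theorem one_step [MeasurableSpace V] [Fintype A]
    (μ : Measure V) (E : Set (V × V × A)) (hG : IsMeasureGraph μ E)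
    (h : ℕ) (L : ℕ → Set V) (hL : IsLayering E h L) (hComm : IsCommutativeGraph E)
    (C : ℝ≥0∞) (hC : 0 < C) (hC' : C ≠ ⊤) (m δ : ℝ≥0∞)
    (hm : ∀ Y, MeasurableSet Y → IsCutset E h L Y → m ≤ graphWeight μ L h C Y)
    (S : Set V) (hS : MeasurableSet S) (hcut : IsCutset E h L S)
    (hw : graphWeight μ L h C S ≤ m + δ) (hmfin : m ≠ ⊤) (i r : ℕ) (hr : i + 2 + r = h) :
    ∃ Z ⊆ L i, MeasurableSet (S \ (S ∩ L (i + 1)) ∪ Z) ∧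
      IsCutset E h L (S \ (S ∩ L (i + 1)) ∪ Z) ∧
      graphWeight μ L h C (S \ (S ∩ L (i + 1)) ∪ Z) ≤
        m + (1 + (Fintype.card A + C * (Fintype.card A + 1))) * δ := by
  have hfin : ∀ X, μ X ≠ ⊤ := fun X =>
    ne_top_of_le_ne_top hG.finiteMeasure (measure_mono (Set.subset_univ X))
  have hc : C⁻¹ ≠ ⊤ := ENNReal.inv_ne_top.2 hC.ne'
  set R := reach E S (L 0) i with hRdef
  set Q := reach (dualEdges E) S (L h) r with hQdef
  set M := S ∩ L (i + 1) with hMdef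
  have hRm : MeasurableSet R := meas_reach hG hS (hL.1 0) i
  have hQm : MeasurableSet Q := meas_reach hG.dual hS (hL.1 h) r
  have hMm : MeasurableSet M := hS.inter (hL.1 _)
  have hRL : R ⊆ L i := reach_layer hL S i
  have hQL : Q ⊆ L (i + 2) := reach_layer_dual hL S r (i + 2) hr
  have hmid := mid_mem hL hcut i r hr
  have hgen : ∀ T Z : Set V, ∀ l, l ≤ h → T ⊆ M → MeasurableSet T → MeasurableSet Z → Z ⊆ L l →
      (∀ x y z a b, x ∈ R → y ∈ T → z ∈ Q → (x, y, a) ∈ E → (y, z, b) ∈ E → x ∈ Z ∨ z ∈ Z) →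
      C⁻¹ ^ (i + 1) * μ T ≤ C⁻¹ ^ l * μ Z + δ := by
    intro T Z l hl hT hTm hZm hZ hTZ
    have h1 := replace_cutset hL hcut i r hr T Z hT hTZ
    have h2 := hm _ ((hS.diff hTm).union hZm) h1
    have h3 := replace_weight μ hL C hS hTm hZm (i + 1) l (by omega) hl hT hZ
    refine (ENNReal.add_le_add_iff_left hmfin).1 ?_
    calc m + C⁻¹ ^ (i + 1) * μ T ≤ _ := by gcongr
      _ ≤ _ := h3
      _ ≤ m + δ + C⁻¹ ^ l * μ Z := by gcongr
      _ = _ := by ring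
  have ineq1 : ∀ k, C⁻¹ ^ (i + 1) * μ (lev E M Q (k + 1)) ≤
      C⁻¹ ^ i * μ (lev E R M (k + 1)) + δ := by
    intro k
    refine hgen _ _ i (by omega) (fun x hx => hx.1) (meas_lev hG hMm hQm _)
      (meas_lev hG hRm hMm _) (fun x hx => hRL hx.1) ?_
    intro x y z a b hx hy hz h1 h2
    exact Or.inl ⟨hx, hy.2.trans (outDeg_mono hG.uniqueOut hComm.1
      (fun x y z a b hx hz => hmid x y z a b hx hz) hx h1)⟩
  have ineq2 : ∀ k, C⁻¹ ^ (i + 1) * μ (lev (dualEdges E) M R (k + 1)) ≤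
      C⁻¹ ^ (i + 2) * μ (lev (dualEdges E) Q M (k + 1)) + δ := by
    intro k
    refine hgen _ _ (i + 2) (by omega) (fun x hx => hx.1) (meas_lev hG.dual hMm hRm _)
      (meas_lev hG.dual hQm hMm _) (fun x hx => hQL hx.1) ?_
    intro x y z a b hx hy hz h1 h2
    exact Or.inr ⟨hz, hy.2.trans (outDeg_mono (E := dualEdges E) hG.dual.uniqueOut hComm.2
      (fun x y z a b hx hz h1 h2 => hmid z y x b a hz hx h2 h1) hz (mem_dual.2 h2))⟩
  have key := arith_step (Fintype.card A) C C⁻¹ δ i (ENNReal.mul_inv_cancel hC.ne' hC') hc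
    (fun k => μ (lev E R M (k + 1))) (fun k => μ (lev E M Q (k + 1)))
    (fun k => μ (lev (dualEdges E) M R (k + 1))) (fun k => μ (lev (dualEdges E) Q M (k + 1)))
    (fun k => hfin _) ineq1 ineq2 (sum_lev_swap hG hRm hMm) (sum_lev_swap hG hMm hQm)
  have hZm : MeasurableSet (lev E R M 1) := meas_lev hG hRm hMm 1
  refine ⟨lev E R M 1, fun x hx => hRL hx.1, (hS.diff hMm).union hZm, ?_, ?_⟩
  · refine replace_cutset hL hcut i r hr M _ subset_rfl ?_
    intro x y z a b hx hy hz h1 h2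
    refine Or.inl ⟨hx, ?_⟩
    classical
    exact Finset.card_pos.2 ⟨a, by simpa using ⟨y, hy, h1⟩⟩
  · have h3 := replace_weight μ hL C hS hMm hZm (i + 1) i (by omega) (by omega) subset_rfl
      (fun x hx => hRL hx.1)
    have hT0 : μ (lev E M Q 1) ≤ μ M := measure_mono fun x hx => hx.1
    refine (ENNReal.add_le_add_iff_right
      (ENNReal.mul_ne_top (ENNReal.pow_ne_top hc) (hfin M) : C⁻¹ ^ (i + 1) * μ M ≠ ⊤)).1 ?_
    calc _ ≤ _ := h3
      _ ≤ m + δ + (C⁻¹ ^ (i + 1) * μ M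
          + (Fintype.card A + C * (Fintype.card A + 1)) * δ) := by
        gcongr
        refine key.trans ?_
        gcongr
      _ = _ := by ring

end Helpers

/-- For an `h`-layered commutative measure graph and any `C > 0` (with weight `w`
corresponding to `C`), for every `ε > 0` there is an `ε`-minimal cutset contained in
`V_0 ∪ V_h`. -/
theorem exists_eps_min_cutset_in_top_and_bottom [MeasurableSpace V] [Fintype A]
    (μ : Measure V) (E : Set (V × V × A)) (hGraph : IsMeasureGraph μ E)
    (h : ℕ) (L : ℕ → Set V) (hLay : IsLayering E h L) (hComm : IsCommutativeGraph E)
    (C : ℝ≥0∞) (hC : 0 < C) (hC' : C ≠ ⊤) :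
    ∀ ε : ℝ≥0∞, 0 < ε → ε ≠ ⊤ →
      ∃ S : Set V, S ⊆ L 0 ∪ L h ∧ IsEpsMinCutset μ E h L C ε S := by
  unfold IsEpsMinCutset
  set m := sInf {w : ℝ≥0∞ | ∃ Y : Set V, MeasurableSet Y ∧ IsCutset E h L Y ∧
        w = graphWeight μ L h C Y} with hmdef
  have hm : ∀ Y, MeasurableSet Y → IsCutset E h L Y → m ≤ graphWeight μ L h C Y :=
    fun Y h1 h2 => sInf_le ⟨Y, h1, h2, rfl⟩
  have hmfin : m ≠ ⊤ := by
    refine ne_top_of_le_ne_top ?_ (hm Set.univ MeasurableSet.univ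
      (fun p _ _ _ => ⟨0, Nat.zero_le _, trivial⟩))
    refine ENNReal.sum_ne_top.2 fun j _ => ENNReal.mul_ne_top
      (ENNReal.pow_ne_top (ENNReal.inv_ne_top.2 hC.ne')) ?_
    exact ne_top_of_le_ne_top hGraph.finiteMeasure (measure_mono (Set.subset_univ _))
  have main : ∀ k : ℕ, ∀ ε : ℝ≥0∞, 0 < ε → ε ≠ ⊤ → ∃ S : Set V,
      (∀ l, l < h → h ≤ l + k → l ≠ 0 → ∀ x ∈ S, x ∉ L l) ∧
      MeasurableSet S ∧ IsCutset E h L S ∧ graphWeight μ L h C S ≤ m + ε := by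
    intro k
    induction k with
    | zero =>
      intro ε hε _
      have hlt : m < m + ε := ENNReal.lt_add_right hmfin hε.ne'
      obtain ⟨w, ⟨Y, h1, h2, rfl⟩, h3⟩ := sInf_lt_iff.1 hlt
      exact ⟨Y, fun l h1 h2 => by omega, h1, h2, h3.le⟩
    | succ k ih =>
      intro ε hε hε'
      by_cases hk : h ≤ k + 1
      · obtain ⟨S, h1, h2⟩ := ih ε hε hε'
        exact ⟨S, fun l hl _ hl0 => h1 l hl (by omega) hl0, h2⟩
      · obtain ⟨i, hi⟩ : ∃ i, i + 2 + k = h := ⟨h - (k + 2), by omega⟩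
        set K : ℝ≥0∞ := 1 + (Fintype.card A + C * (Fintype.card A + 1)) with hK
        have hK0 : K ≠ 0 := by simp [hK]
        have hKt : K ≠ ⊤ := by
          simp only [hK, ne_eq, ENNReal.add_eq_top, not_or]
          refine ⟨ENNReal.one_ne_top, ENNReal.natCast_ne_top _, ENNReal.mul_ne_top hC' ?_⟩
          exact ENNReal.add_ne_top.2 ⟨ENNReal.natCast_ne_top _, ENNReal.one_ne_top⟩
        obtain ⟨S, h1, h2, h3, h4⟩ := ih (ε / K) (ENNReal.div_pos hε.ne' hKt)
          (ENNReal.div_ne_top hε' hK0)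
        obtain ⟨Z, hZ, z1, z2, z3⟩ := one_step μ E hGraph h L hLay hComm C hC hC' m (ε / K) hm S
          h2 h3 h4 hmfin i k hi
        refine ⟨_, ?_, z1, z2, ?_⟩
        · rintro l hl hl1 hl0 x (⟨hx, hx'⟩ | hx) hxl
          · by_cases hli : l = i + 1
            · subst hli
              exact hx' ⟨hx, hxl⟩
            · exact h1 l hl (by omega) hl0 x hx hxl
          · have := layer_unique hLay (hZ hx) hxl
            omega
        · rwa [ENNReal.mul_div_cancel hK0 hKt] at z3
  intro ε hε hε'
  obtain ⟨S, h1, h2, h3, h4⟩ := main h ε hε hε'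
  refine ⟨S, ?_, h2, h3, h4⟩
  intro x hx
  have hxu : x ∈ ⋃ i ∈ Finset.range (h + 1), L i := hLay.2.1 ▸ Set.mem_univ x
  simp only [Set.mem_iUnion, Finset.mem_range] at hxu
  obtain ⟨l, hl, hxl⟩ := hxu
  by_cases h0 : l = 0
  · subst h0
    exact Or.inl hxl
  by_cases hh : l = h
  · subst hh
    exact Or.inr hxl
  exact absurd hxl (h1 l (by omega) (by omega) h0 x hx)
end

section
/- Let G be a countable abelian group acting on a probability space (X, 𝓑, μ), let A ⊆ G be finite, let B ∈ 𝓑 with μ(B) > 0, let 0 < δ < 1, and let j ≤ k be positive integers. Then c_δ(A^k, B)^{1/k} ≤ (1-δ)^{-1/j} · (μ(A^j B)/μ(B))^{1/j}. -/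
open Filter MeasureTheory Pointwise ENNReal

/-- The `δ`-heavy magnification ratio
`c_δ(A, B) = inf { μ(A B') / μ(B') : B' ⊆ B measurable, μ(B') ≥ δ·μ(B) }`,
where `A B' = ⋃_{a ∈ A} a • B'`. -/
noncomputable def magRatioHeavy {G X : Type*} [SMul G X] [MeasurableSpace X]
    (μ : Measure X) (δ : ℝ) (A : Set G) (B : Set X) : ℝ≥0∞ :=
  sInf {r : ℝ≥0∞ | ∃ B' : Set X, B' ⊆ B ∧ MeasurableSet B' ∧
    ENNReal.ofReal δ * μ B ≤ μ B' ∧ r = μ (A • B') / μ B'}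

section aux

variable {G X : Type*} [CommGroup G] [MulAction G X] [MeasurableSpace X]

lemma aux_finite_pow {G : Type*} [CommGroup G] {A : Set G} (hA : A.Finite) (n : ℕ) :
    (A ^ n).Finite := by
  induction n with
  | zero => simp
  | succ n ih => rw [pow_succ]; exact Set.Finite.mul ih hA

/-- measurability of a translate -/
lemma aux_meas_smul (hmeas : ∀ g : G, Measurable (fun x : X => g • x)) (g : G) {S : Set X}
    (hS : MeasurableSet S) : MeasurableSet (g • S) := by
  rw [← Set.preimage_smul_inv]
  exact hmeas g⁻¹ hS

lemma aux_meas_set_smul (hmeas : ∀ g : G, Measurable (fun x : X => g • x)) {A : Set G}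
    (hA : A.Finite) {S : Set X} (hS : MeasurableSet S) : MeasurableSet (A • S) := by
  rw [← Set.iUnion_smul_set]
  exact hA.measurableSet_biUnion fun a _ => aux_meas_smul hmeas a hS

/-- The measure of `A • S` is at most `|A|` times that of `S`. -/
lemma aux_real_smul_le (μ : Measure X) [IsProbabilityMeasure μ]
    (hinv : ∀ (g : G) (S : Set X), MeasurableSet S → μ (g • S) = μ S)
    (A : Finset G) {S : Set X} (hS : MeasurableSet S) :
    μ.real ((A : Set G) • S) ≤ A.card * μ.real S := by
  rw [← Set.iUnion_smul_set]
  calc μ.real (⋃ a ∈ (A : Set G), a • S) ≤ ∑ a ∈ A, μ.real (a • S) := by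
        simpa using measureReal_biUnion_finset_le (μ := μ) A (fun a => a • S)
    _ = ∑ a ∈ A, μ.real S := by
        refine Finset.sum_congr rfl fun a _ => ?_
        simp [Measure.real, hinv a S hS]
    _ = _ := by simp

open Classical in
/-- points lying in more than `t` of the sets `E a` -/
def auxLev {X ι : Type*} (A : Finset ι) (E : ι → Set X) (t : ℕ) : Set X :=
  {x | t < (A.filter (fun a => x ∈ E a)).card}

lemma auxLev_exists {X ι : Type*} {A : Finset ι} {E : ι → Set X} {t : ℕ} {x : X}
    (hx : x ∈ auxLev A E t) : ∃ a ∈ A, x ∈ E a := by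
  classical
  obtain ⟨a, ha⟩ := Finset.card_pos.1 (lt_of_le_of_lt (Nat.zero_le t) hx)
  exact ⟨a, (Finset.mem_filter.1 ha).1, (Finset.mem_filter.1 ha).2⟩

lemma auxLev_mono {X ι : Type*} {A : Finset ι} {E E' : ι → Set X} {t : ℕ} {x y : X}
    (hx : x ∈ auxLev A E t) (h : ∀ a ∈ A, x ∈ E a → y ∈ E' a) : y ∈ auxLev A E' t := by
  classical
  refine lt_of_lt_of_le hx (Finset.card_le_card ?_)
  intro b hb
  have := Finset.mem_filter.1 hb
  exact Finset.mem_filter.2 ⟨this.1, h b this.1 this.2⟩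

open Classical in
/-- Layer cake formula for a finite family of sets. -/
lemma aux_layer {ι : Type*} (μ : Measure X) [IsProbabilityMeasure μ] (A : Finset ι)
    (E : ι → Set X) (hE : ∀ a, MeasurableSet (E a)) :
    (∀ t : ℕ, MeasurableSet (auxLev A E t)) ∧
    ∑ a ∈ A, μ.real (E a) =
      ∑ t ∈ Finset.range A.card, μ.real (auxLev A E t) := by
  have hd : Measurable (fun x => (A.filter (fun a => x ∈ E a)).card) := by
    have : (fun x => (A.filter (fun a => x ∈ E a)).card)
        = fun x => ∑ a ∈ A, (E a).indicator (fun _ => (1 : ℕ)) x := by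
      funext x
      rw [Finset.card_filter]
      exact Finset.sum_congr rfl fun a _ => by simp [Set.indicator_apply]
    rw [this]
    exact Finset.measurable_sum _ fun a _ => measurable_const.indicator (hE a)
  have hm : ∀ t : ℕ, MeasurableSet (auxLev A E t) := fun t =>
    hd (measurableSet_Ioi (a := t))
  refine ⟨hm, ?_⟩
  have key : ∀ (s : Set X), MeasurableSet s → μ.real s = ∫ x, s.indicator (fun _ => (1 : ℝ)) x ∂μ := by
    intro s hs
    rw [integral_indicator_const _ hs]; simp
  have hint : ∀ (s : Set X), MeasurableSet s →
      Integrable (fun x => s.indicator (fun _ => (1 : ℝ)) x) μ := fun s hs =>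
    (integrable_const (1 : ℝ)).indicator hs
  rw [Finset.sum_congr rfl fun a _ => key _ (hE a),
    Finset.sum_congr rfl fun t _ => key _ (hm t),
    ← integral_finsetSum _ fun a _ => hint _ (hE a),
    ← integral_finsetSum _ fun t _ => hint _ (hm t)]
  congr 1
  funext x
  have hle : (A.filter (fun a => x ∈ E a)).card ≤ A.card := Finset.card_filter_le _ _
  simp only [Set.indicator_apply, auxLev, Set.mem_ofPred_eq]
  rw [Finset.sum_boole, Finset.sum_boole]
  congr 1
  generalize (A.filter (fun a => x ∈ E a)).card = d at hle
  have : (Finset.range A.card).filter (fun t => t < d) = Finset.range d := by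
    ext t; simp; omega
  rw [this, Finset.card_range]

/-- The key double counting argument. -/
lemma aux_edge (μ : Measure X) [IsProbabilityMeasure μ]
    (hmeas : ∀ g : G, Measurable (fun x : X => g • x))
    (hinv : ∀ (g : G) (S : Set X), MeasurableSet S → μ (g • S) = μ S)
    (A : Finset G) (U T : Set X) (hU : MeasurableSet U) (hT : MeasurableSet T)
    (α β ε : ℝ) (hα : 0 < α) (hαβ : 1 < α * β)
    (H1 : ∀ Z ⊆ ((A : Set G) • U) \ T, MeasurableSet Z →
      α * μ.real Z ≤ μ.real (U ∩ ((A : Set G)⁻¹ • Z)) + ε)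
    (H2 : ∀ Z ⊆ ((A : Set G) • U) \ T, MeasurableSet Z →
      β * μ.real Z ≤ μ.real (((A : Set G) • Z) \ ((A : Set G) • T)) + ε) :
    (α * β - 1) * μ.real (((A : Set G) • U) \ T) ≤ (1 + α) * (A.card * ε) := by
  have hR : MeasurableSet ((A : Set G) • U) := aux_meas_set_smul hmeas A.finite_toSet hU
  have hAT : MeasurableSet ((A : Set G) • T) := aux_meas_set_smul hmeas A.finite_toSet hT
  set M := ((A : Set G) • U) \ T with hMdef
  have hM : MeasurableSet M := hR.diff hT
  set N := ((A : Set G) • M) \ ((A : Set G) • T) with hNdef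
  have hN : MeasurableSet N := (aux_meas_set_smul hmeas A.finite_toSet hM).diff hAT
  -- the four families
  let E1 : G → Set X := fun a => U ∩ (a⁻¹ • M)
  let E1' : G → Set X := fun a => M ∩ (a • U)
  let E2 : G → Set X := fun a => M ∩ (a⁻¹ • N)
  let E2' : G → Set X := fun a => N ∩ (a • M)
  have mE1 : ∀ a, MeasurableSet (E1 a) := fun a => hU.inter (aux_meas_smul hmeas _ hM)
  have mE1' : ∀ a, MeasurableSet (E1' a) := fun a => hM.inter (aux_meas_smul hmeas _ hU)
  have mE2 : ∀ a, MeasurableSet (E2 a) := fun a => hM.inter (aux_meas_smul hmeas _ hN)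
  have mE2' : ∀ a, MeasurableSet (E2' a) := fun a => hN.inter (aux_meas_smul hmeas _ hM)
  have e1 : ∀ a, μ.real (E1' a) = μ.real (E1 a) := by
    intro a
    have : E1' a = a • E1 a := by
      simp only [E1, E1', Set.smul_set_inter, smul_inv_smul, Set.inter_comm]
    rw [this]; simp [Measure.real, hinv a _ (mE1 a)]
  have e2 : ∀ a, μ.real (E2' a) = μ.real (E2 a) := by
    intro a
    have : E2' a = a • E2 a := by
      simp only [E2, E2', Set.smul_set_inter, smul_inv_smul, Set.inter_comm]
    rw [this]; simp [Measure.real, hinv a _ (mE2 a)]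
  obtain ⟨q1, l1⟩ := aux_layer μ A E1 mE1
  obtain ⟨q1', l1'⟩ := aux_layer μ A E1' mE1'
  obtain ⟨q2, l2⟩ := aux_layer μ A E2 mE2
  obtain ⟨q2', l2'⟩ := aux_layer μ A E2' mE2'
  have I1 : α * ∑ a ∈ A, μ.real (E2 a) ≤ (∑ a ∈ A, μ.real (E1 a)) + A.card * ε := by
    rw [l2, l1, Finset.mul_sum]
    have : (A.card : ℝ) * ε = ∑ t ∈ Finset.range A.card, ε := by simp
    rw [this, ← Finset.sum_add_distrib]
    refine Finset.sum_le_sum fun t _ => ?_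
    refine (H1 _ ?_ (q2 t)).trans ?_
    · intro x hx
      obtain ⟨a, _, ha⟩ := auxLev_exists hx
      exact ha.1
    · gcongr
      · exact measure_ne_top _ _
      rintro u ⟨hu, a', ha', m, hm, rfl⟩
      have haA : a'⁻¹ ∈ A := by simpa using ha'
      refine auxLev_mono hm fun b hbA ⟨hmM, hbN⟩ => ⟨hu, ?_⟩
      rw [Set.mem_inv_smul_set_iff] at hbN ⊢
      refine ⟨⟨b, hbA, _, hu, rfl⟩, fun hbT => hbN.2 ⟨a'⁻¹, haA, _, hbT, ?_⟩⟩
      simp only [smul_smul]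
      congr 1
      rw [mul_comm b a', inv_mul_cancel_left]
  have I2 : β * ∑ a ∈ A, μ.real (E1 a) ≤ (∑ a ∈ A, μ.real (E2 a)) + A.card * ε := by
    rw [← Finset.sum_congr rfl fun a _ => e1 a, ← Finset.sum_congr rfl fun a _ => e2 a,
      l2', l1', Finset.mul_sum]
    have : (A.card : ℝ) * ε = ∑ t ∈ Finset.range A.card, ε := by simp
    rw [this, ← Finset.sum_add_distrib]
    refine Finset.sum_le_sum fun t _ => ?_
    have hsub : auxLev A E1' t ⊆ M := by
      intro x hx
      obtain ⟨a, _, ha⟩ := auxLev_exists hx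
      exact ha.1
    refine (H2 _ hsub (q1' t)).trans ?_
    gcongr
    · exact measure_ne_top _ _
    rintro n ⟨⟨b, hbA, m, hm, rfl⟩, hnT⟩
    refine auxLev_mono hm fun a haA ⟨hmM, u, hu, hum⟩ => ⟨⟨⟨b, hbA, m, hmM, rfl⟩, hnT⟩, ?_⟩
    have hum' : a • u = m := hum
    have hab : a • (b • u) = b • m := by rw [← hum', smul_comm]
    refine ⟨b • u, ⟨⟨b, hbA, u, hu, rfl⟩, fun hbT => hnT ⟨a, haA, _, hbT, hab⟩⟩, hab⟩
  have I3 : μ.real M ≤ ∑ a ∈ A, μ.real (E1 a) := by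
    rw [← Finset.sum_congr rfl fun a _ => e1 a]
    refine le_trans (measureReal_mono ?_ (measure_ne_top _ _)) (measureReal_biUnion_finset_le A E1')
    intro m hm
    obtain ⟨a, ha, u, hu, hum⟩ := hm.1
    exact Set.mem_biUnion (show a ∈ (A : Set G) from ha) ⟨hm, u, hu, hum⟩
  calc (α * β - 1) * μ.real M ≤ (α * β - 1) * ∑ a ∈ A, μ.real (E1 a) := by
        apply mul_le_mul_of_nonneg_left I3; linarith
    _ ≤ _ := by nlinarith [mul_le_mul_of_nonneg_left I2 hα.le]

/-- Vertices in layer `n` reachable from `B` while avoiding the sets `S i`. -/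
def auxReach (A : Set G) (B : Set X) (S : ℕ → Set X) : ℕ → Set X
  | 0 => B \ S 0
  | n + 1 => (A • auxReach A B S n) \ S (n + 1)

lemma auxReach_meas (hmeas : ∀ g : G, Measurable (fun x : X => g • x)) {A : Set G}
    (hA : A.Finite) {B : Set X} (hB : MeasurableSet B) {S : ℕ → Set X}
    (hS : ∀ i, MeasurableSet (S i)) (n : ℕ) : MeasurableSet (auxReach A B S n) := by
  induction n with
  | zero => exact hB.diff (hS 0)
  | succ n ih => exact (aux_meas_set_smul hmeas hA ih).diff (hS _)

lemma auxReach_congr (A : Set G) (B : Set X) (S S' : ℕ → Set X) (n : ℕ)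
    (h : ∀ i ≤ n, S i = S' i) : auxReach A B S n = auxReach A B S' n := by
  induction n with
  | zero => simp [auxReach, h 0 le_rfl]
  | succ n ih => simp only [auxReach, h (n + 1) le_rfl, ih fun i hi => h i (by omega)]

lemma auxReach_mono (A : Set G) (B : Set X) (S S' : ℕ → Set X) (n m : ℕ) (hnm : n ≤ m)
    (h : ∀ i, n < i → S i = S' i) (h0 : auxReach A B S n ⊆ auxReach A B S' n) :
    auxReach A B S m ⊆ auxReach A B S' m := by
  induction m, hnm using Nat.le_induction with
  | base => exact h0
  | succ m hm ih =>
    simp only [auxReach, h (m + 1) (by omega)]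
    exact Set.sdiff_subset_sdiff_left (Set.smul_subset_smul_left ih)

/-- weight of a separating family -/
noncomputable def auxW (μ : Measure X) (w : ℕ → ℝ) (k : ℕ) (S : ℕ → Set X) : ℝ :=
  ∑ i ∈ Finset.range (k + 1), w i * μ.real (S i)

lemma auxW_update (μ : Measure X) (w : ℕ → ℝ) (k : ℕ) (S : ℕ → Set X) (n : ℕ) (hn : n ≤ k)
    (Z : Set X) : auxW μ w k (Function.update S n Z) =
      auxW μ w k S + w n * (μ.real Z - μ.real (S n)) := by
  have hmem : n ∈ Finset.range (k + 1) := Finset.mem_range.2 (by omega)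
  unfold auxW
  rw [← Finset.add_sum_erase _ _ hmem, ← Finset.add_sum_erase _ (fun i => w i * μ.real (S i)) hmem]
  have : ∑ x ∈ (Finset.range (k + 1)).erase n, w x * μ.real (Function.update S n Z x) =
      ∑ x ∈ (Finset.range (k + 1)).erase n, w x * μ.real (S x) :=
    Finset.sum_congr rfl fun x hx => by
      rw [Function.update_of_ne (Finset.ne_of_mem_erase hx)]
  rw [this, Function.update_self]
  ring

/-- In an almost optimal separating family the middle layers are small. -/
lemma aux_middle (μ : Measure X) [IsProbabilityMeasure μ]
    (hmeas : ∀ g : G, Measurable (fun x : X => g • x))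
    (hinv : ∀ (g : G) (S : Set X), MeasurableSet S → μ (g • S) = μ S)
    (A : Finset G) (B : Set X) (hB : MeasurableSet B) (w : ℕ → ℝ) (k : ℕ)
    (hw : ∀ i, 0 < w i) (n : ℕ) (hn : n + 2 ≤ k) (hlog : w n * w (n + 2) < w (n + 1) ^ 2)
    (S : ℕ → Set X) (hS : ∀ i, MeasurableSet (S i)) (hSk : auxReach (A : Set G) B S k = ∅)
    (ε : ℝ)
    (hmin : ∀ S' : ℕ → Set X, (∀ i, MeasurableSet (S' i)) → auxReach (A : Set G) B S' k = ∅ →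
      auxW μ w k S ≤ auxW μ w k S' + ε) :
    (w (n + 1) / w n * (w (n + 1) / w (n + 2)) - 1) *
      μ.real (((A : Set G) • auxReach (A : Set G) B S n) \ auxReach (A : Set G) B S (n + 1)) ≤
      (1 + w (n + 1) / w n) * (A.card * ((1 / w n + 1 / w (n + 2)) * ε)) := by
  have hε : 0 ≤ ε := by have := hmin S hS hSk; linarith
  have hw0 := hw n
  have hw1 := hw (n + 1)
  have hw2 := hw (n + 2)
  have mU := auxReach_meas hmeas A.finite_toSet hB hS n
  have mT := auxReach_meas hmeas A.finite_toSet hB hS (n + 1)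
  have hZS : ∀ Z ⊆ ((A : Set G) • auxReach (A : Set G) B S n) \ auxReach (A : Set G) B S (n + 1),
      Z ⊆ S (n + 1) := by
    intro Z hZ z hz
    by_contra h
    exact (hZ hz).2 ⟨(hZ hz).1, h⟩
  refine aux_edge μ hmeas hinv A _ _ mU mT _ _ _ (by positivity) ?_ ?_ ?_
  · rw [div_mul_div_comm, one_lt_div (by positivity)]
    nlinarith
  · intro Z hZ mZ
    have mAZ : MeasurableSet ((A : Set G)⁻¹ • Z) :=
      aux_meas_set_smul hmeas A.finite_toSet.inv mZ
    set P := auxReach (A : Set G) B S n ∩ ((A : Set G)⁻¹ • Z) with hP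
    have mP : MeasurableSet P := mU.inter mAZ
    set S' := Function.update (Function.update S (n + 1) (S (n + 1) \ Z)) n (S n ∪ P) with hS'
    have s0 : S' n = S n ∪ P := by simp [hS']
    have s1 : S' (n + 1) = S (n + 1) \ Z := by simp [hS']
    have so : ∀ i, i ≠ n → i ≠ n + 1 → S' i = S i := by
      intro i h1 h2; simp [hS', h1, h2]
    have mS' : ∀ i, MeasurableSet (S' i) := by
      intro i
      by_cases h1 : i = n
      · subst h1; rw [s0]; exact (hS _).union mP
      by_cases h2 : i = n + 1
      · subst h2; rw [s1]; exact (hS _).diff mZ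
      rw [so i h1 h2]; exact hS i
    have r0 : auxReach (A : Set G) B S' n ⊆ auxReach (A : Set G) B S n \ ((A : Set G)⁻¹ • Z) := by
      have : auxReach (A : Set G) B S' n ⊆ auxReach (A : Set G) B S n \ P := by
        cases n with
        | zero => simp only [auxReach, s0]; intro x hx; simp_all
        | succ p =>
          have : auxReach (A : Set G) B S' p = auxReach (A : Set G) B S p :=
            auxReach_congr _ _ _ _ _ fun i hi => so i (by omega) (by omega)
          rw [auxReach, this, s0]
          intro x hx
          refine ⟨⟨hx.1, fun h => hx.2 (Or.inl h)⟩, fun h => hx.2 (Or.inr h)⟩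
      intro x hx
      exact ⟨(this hx).1, fun h => (this hx).2 ⟨(this hx).1, h⟩⟩
    have r1 : auxReach (A : Set G) B S' (n + 1) ⊆ auxReach (A : Set G) B S (n + 1) := by
      rw [auxReach, s1]
      rintro x ⟨⟨a, ha, u, hu, rfl⟩, hx⟩
      refine ⟨⟨a, ha, u, (r0 hu).1, rfl⟩, fun h => hx ⟨h, fun hz => (r0 hu).2 ?_⟩⟩
      exact ⟨a⁻¹, by simpa using ha, _, hz, by simp⟩
    have rk : auxReach (A : Set G) B S' k = ∅ := by
      have := auxReach_mono (A : Set G) B S' S (n + 1) k (by omega)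
        (fun i hi => so i (by omega) (by omega)) r1
      rwa [hSk, Set.subset_empty_iff] at this
    have := hmin S' mS' rk
    rw [hS', auxW_update _ _ _ _ _ (by omega), auxW_update _ _ _ _ _ (by omega),
      Function.update_of_ne (by omega), measureReal_sdiff (hZS Z hZ) mZ] at this
    have hu : μ.real (S n ∪ P) ≤ μ.real (S n) + μ.real P := measureReal_union_le _ _
    have h3 : w (n + 1) * μ.real Z ≤ w n * μ.real P + ε := by
      nlinarith [mul_le_mul_of_nonneg_left hu hw0.le]
    have h4 : w (n + 1) / w n * μ.real Z ≤ μ.real P + 1 / w n * ε := by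
      rw [div_mul_eq_mul_div, div_le_iff₀ hw0]
      have : (μ.real P + 1 / w n * ε) * w n = w n * μ.real P + ε := by field_simp
      linarith
    have : 0 ≤ 1 / w (n + 2) * ε := by positivity
    linarith
  · intro Z hZ mZ
    have mP := (aux_meas_set_smul hmeas A.finite_toSet mZ).diff
      (aux_meas_set_smul hmeas A.finite_toSet mT)
    set P := ((A : Set G) • Z) \ ((A : Set G) • auxReach (A : Set G) B S (n + 1)) with hP
    set S' := Function.update (Function.update S (n + 1) (S (n + 1) \ Z)) (n + 2) (S (n + 2) ∪ P)
      with hS'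
    have s0 : S' (n + 2) = S (n + 2) ∪ P := by simp [hS']
    have s1 : S' (n + 1) = S (n + 1) \ Z := by simp [hS']
    have so : ∀ i, i ≠ n + 2 → i ≠ n + 1 → S' i = S i := by
      intro i h1 h2; simp [hS', h1, h2]
    have mS' : ∀ i, MeasurableSet (S' i) := by
      intro i
      by_cases h1 : i = n + 2
      · subst h1; rw [s0]; exact (hS _).union mP
      by_cases h2 : i = n + 1
      · subst h2; rw [s1]; exact (hS _).diff mZ
      rw [so i h1 h2]; exact hS i
    have r0 : auxReach (A : Set G) B S' n = auxReach (A : Set G) B S n :=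
      auxReach_congr _ _ _ _ _ fun i hi => so i (by omega) (by omega)
    have r1 : auxReach (A : Set G) B S' (n + 1) ⊆ auxReach (A : Set G) B S (n + 1) ∪ Z := by
      rw [auxReach, s1, r0]
      rintro x ⟨hx, hx'⟩
      by_cases hz : x ∈ Z
      · exact Or.inr hz
      · exact Or.inl ⟨hx, fun h => hx' ⟨h, hz⟩⟩
    have r2 : auxReach (A : Set G) B S' (n + 2) ⊆ auxReach (A : Set G) B S (n + 2) := by
      rw [auxReach, s0]
      rintro x ⟨⟨a, ha, u, hu, rfl⟩, hx⟩
      refine ⟨?_, fun h => hx (Or.inl h)⟩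
      rcases r1 hu with h | h
      · exact ⟨a, ha, u, h, rfl⟩
      · by_contra h'
        exact hx (Or.inr ⟨⟨a, ha, u, h, rfl⟩, h'⟩)
    have rk : auxReach (A : Set G) B S' k = ∅ := by
      have := auxReach_mono (A : Set G) B S' S (n + 2) k (by omega)
        (fun i hi => so i (by omega) (by omega)) r2
      rwa [hSk, Set.subset_empty_iff] at this
    have := hmin S' mS' rk
    rw [hS', auxW_update _ _ _ _ _ (by omega), auxW_update _ _ _ _ _ (by omega),
      Function.update_of_ne (by omega), measureReal_sdiff (hZS Z hZ) mZ] at this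
    have hu : μ.real (S (n + 2) ∪ P) ≤ μ.real (S (n + 2)) + μ.real P := measureReal_union_le _ _
    have h3 : w (n + 1) * μ.real Z ≤ w (n + 2) * μ.real P + ε := by
      nlinarith [mul_le_mul_of_nonneg_left hu hw2.le]
    have h4 : w (n + 1) / w (n + 2) * μ.real Z ≤ μ.real P + 1 / w (n + 2) * ε := by
      rw [div_mul_eq_mul_div, div_le_iff₀ hw2]
      have : (μ.real P + 1 / w (n + 2) * ε) * w (n + 2) = w (n + 2) * μ.real P + ε := by field_simp
      linarith
    have : 0 ≤ 1 / w n * ε := by positivity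
    linarith

/-- `A^i T_0` is almost contained in the reachable part of layer `i`. -/
lemma aux_reach_defect (μ : Measure X) [IsProbabilityMeasure μ]
    (hmeas : ∀ g : G, Measurable (fun x : X => g • x))
    (hinv : ∀ (g : G) (S : Set X), MeasurableSet S → μ (g • S) = μ S)
    (A : Finset G) (B : Set X) (hB : MeasurableSet B) (w : ℕ → ℝ) (k : ℕ)
    (hw : ∀ i, 0 < w i) (hlog : ∀ n, n + 2 ≤ k → w n * w (n + 2) < w (n + 1) ^ 2)
    (n : ℕ) (hn : n + 1 ≤ k) :
    ∃ K : ℝ, 0 ≤ K ∧ ∀ (S : ℕ → Set X) (ε : ℝ), (∀ i, MeasurableSet (S i)) →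
      auxReach (A : Set G) B S k = ∅ →
      (∀ S' : ℕ → Set X, (∀ i, MeasurableSet (S' i)) → auxReach (A : Set G) B S' k = ∅ →
        auxW μ w k S ≤ auxW μ w k S' + ε) →
      μ.real (((A : Set G) ^ (n + 1) • auxReach (A : Set G) B S 0) \
        ((A : Set G) • auxReach (A : Set G) B S n)) ≤ K * ε := by
  induction n with
  | zero =>
    refine ⟨0, le_rfl, fun S ε _ _ _ => ?_⟩
    simp
  | succ n ih =>
    obtain ⟨K, hK, h⟩ := ih (by omega)
    have hw0 := hw n
    have hw1 := hw (n + 1)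
    have hw2 := hw (n + 2)
    have hpos : 0 < w (n + 1) / w n * (w (n + 1) / w (n + 2)) - 1 := by
      have := hlog n (by omega)
      rw [sub_pos, div_mul_div_comm, one_lt_div (by positivity)]
      nlinarith
    set c := w (n + 1) / w n * (w (n + 1) / w (n + 2)) - 1
    set L := (1 + w (n + 1) / w n) * (A.card * (1 / w n + 1 / w (n + 2))) with hL
    refine ⟨A.card * (K + L / c), by positivity, fun S ε mS hSk hmin => ?_⟩
    have h1 := h S ε mS hSk hmin
    have h2 := aux_middle μ hmeas hinv A B hB w k hw n (by omega) (hlog n (by omega)) S mS hSk ε hmin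
    have h2' : μ.real (((A : Set G) • auxReach (A : Set G) B S n) \
        auxReach (A : Set G) B S (n + 1)) ≤ L / c * ε := by
      rw [div_mul_eq_mul_div, le_div_iff₀ hpos]
      have : (1 + w (n + 1) / w n) * (A.card * ((1 / w n + 1 / w (n + 2)) * ε)) = L * ε := by
        rw [hL]; ring
      linarith
    have m0 := auxReach_meas hmeas A.finite_toSet hB mS 0
    have mn := auxReach_meas hmeas A.finite_toSet hB mS n
    have mn1 := auxReach_meas hmeas A.finite_toSet hB mS (n + 1)
    have mA0 : MeasurableSet ((A : Set G) ^ (n + 1) • auxReach (A : Set G) B S 0) :=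
      aux_meas_set_smul hmeas (aux_finite_pow A.finite_toSet _) m0
    set Q := ((A : Set G) ^ (n + 1) • auxReach (A : Set G) B S 0)
    have hsub : ((A : Set G) ^ (n + 1 + 1) • auxReach (A : Set G) B S 0) \
        ((A : Set G) • auxReach (A : Set G) B S (n + 1)) ⊆
        (A : Set G) • (Q \ auxReach (A : Set G) B S (n + 1)) := by
      rw [pow_succ' _ (n + 1), mul_smul]
      rintro x ⟨⟨a, ha, y, hy, rfl⟩, hx⟩
      exact ⟨a, ha, y, ⟨hy, fun h => hx ⟨a, ha, y, h, rfl⟩⟩, rfl⟩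
    have hsub2 : Q \ auxReach (A : Set G) B S (n + 1) ⊆
        (Q \ ((A : Set G) • auxReach (A : Set G) B S n)) ∪
        (((A : Set G) • auxReach (A : Set G) B S n) \ auxReach (A : Set G) B S (n + 1)) := by
      intro x hx
      by_cases h : x ∈ ((A : Set G) • auxReach (A : Set G) B S n)
      · exact Or.inr ⟨h, hx.2⟩
      · exact Or.inl ⟨hx.1, h⟩
    calc _ ≤ μ.real ((A : Set G) • (Q \ auxReach (A : Set G) B S (n + 1))) :=
          measureReal_mono hsub (measure_ne_top _ _)
      _ ≤ A.card * μ.real (Q \ auxReach (A : Set G) B S (n + 1)) :=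
          aux_real_smul_le μ hinv A (mA0.diff mn1)
      _ ≤ A.card * (K * ε + L / c * ε) := by
          gcongr
          refine (measureReal_mono hsub2 (measure_ne_top _ _)).trans ?_
          exact (measureReal_union_le _ _).trans (add_le_add h1 h2')
      _ = _ := by ring

/-- Weighted Plünnecke inequality. -/
lemma aux_core (μ : Measure X) [IsProbabilityMeasure μ]
    (hmeas : ∀ g : G, Measurable (fun x : X => g • x))
    (hinv : ∀ (g : G) (S : Set X), MeasurableSet S → μ (g • S) = μ S)
    (A : Finset G) (B : Set X) (hB : MeasurableSet B) (w : ℕ → ℝ) (j k : ℕ)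
    (hj : 0 < j) (hjk : j ≤ k) (hw0 : w 0 = 1)
    (hw : ∀ i, 0 < w i) (hlog : ∀ n, n + 2 ≤ k → w n * w (n + 2) < w (n + 1) ^ 2)
    (η : ℝ) (hη : 0 < η) :
    ∃ T ⊆ B, MeasurableSet T ∧ μ.real (B \ T) + w k * μ.real ((A : Set G) ^ k • T) ≤
      w j * μ.real ((A : Set G) ^ j • B) + η := by
  obtain ⟨p, rfl⟩ : ∃ p, k = p + 1 := ⟨k - 1, by omega⟩
  obtain ⟨K, hK, hdef⟩ := aux_reach_defect μ hmeas hinv A B hB w (p + 1) hw hlog p le_rfl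
  -- the trivial separating family
  let S0 : ℕ → Set X := Function.update (fun _ => ∅) j ((A : Set G) ^ j • B)
  have mS0 : ∀ i, MeasurableSet (S0 i) := by
    intro i
    by_cases h : i = j
    · subst h; simp only [S0, Function.update_self]
      exact aux_meas_set_smul hmeas (aux_finite_pow A.finite_toSet _) hB
    · simp [S0, h]
  have reach_sub : ∀ (S : ℕ → Set X) (i : ℕ), auxReach (A : Set G) B S i ⊆ (A : Set G) ^ i • B := by
    intro S i
    induction i with
    | zero => simp [auxReach]
    | succ i ih =>
      rw [auxReach, pow_succ', mul_smul]
      exact Set.sdiff_subset.trans (Set.smul_subset_smul_left ih)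
  have rS0 : auxReach (A : Set G) B S0 (p + 1) = ∅ := by
    have hjj : auxReach (A : Set G) B S0 j ⊆ auxReach (A : Set G) B (fun _ => Set.univ) j := by
      obtain ⟨q, rfl⟩ : ∃ q, j = q + 1 := ⟨j - 1, by omega⟩
      intro x hx
      exact absurd (reach_sub _ _ hx) (by simpa [S0] using hx.2)
    have h1 : auxReach (A : Set G) B S0 j = ∅ := by
      obtain ⟨q, rfl⟩ : ∃ q, j = q + 1 := ⟨j - 1, by omega⟩
      simpa [auxReach] using hjj
    have h2 : ∀ m, j ≤ m → auxReach (A : Set G) B S0 m = ∅ := by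
      intro m hm
      induction m, hm using Nat.le_induction with
      | base => exact h1
      | succ m hm ih => simp [auxReach, ih]
    exact h2 _ hjk
  have hWS0 : auxW μ w (p + 1) S0 = w j * μ.real ((A : Set G) ^ j • B) := by
    simp only [S0]
    rw [auxW_update _ _ _ _ _ hjk]
    simp [auxW]
  -- near minimisers
  have hwk := hw (p + 1)
  set ε := η / (1 + w (p + 1) * K) with hε
  have hden : 0 < 1 + w (p + 1) * K := by positivity
  have hεpos : 0 < ε := by positivity
  obtain ⟨S, ⟨mS, rS⟩, hmin⟩ : ∃ S : ℕ → Set X, ((∀ i, MeasurableSet (S i)) ∧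
      auxReach (A : Set G) B S (p + 1) = ∅) ∧ ∀ S' : ℕ → Set X, (∀ i, MeasurableSet (S' i)) →
      auxReach (A : Set G) B S' (p + 1) = ∅ → auxW μ w (p + 1) S ≤ auxW μ w (p + 1) S' + ε := by
    let 𝒮 : Set (ℕ → Set X) := {S | (∀ i, MeasurableSet (S i)) ∧
      auxReach (A : Set G) B S (p + 1) = ∅}
    have hne : (auxW μ w (p + 1) '' 𝒮).Nonempty := ⟨_, S0, ⟨mS0, rS0⟩, rfl⟩
    have hbdd : BddBelow (auxW μ w (p + 1) '' 𝒮) := by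
      refine ⟨0, ?_⟩
      rintro _ ⟨S, _, rfl⟩
      exact Finset.sum_nonneg fun i _ => mul_nonneg (hw i).le measureReal_nonneg
    obtain ⟨_, ⟨S, hS, rfl⟩, hlt⟩ := exists_lt_of_csInf_lt hne
      (lt_add_of_pos_right (sInf (auxW μ w (p + 1) '' 𝒮)) hεpos)
    refine ⟨S, hS, fun S' m' r' => ?_⟩
    have := csInf_le hbdd (Set.mem_image_of_mem (auxW μ w (p + 1)) (show S' ∈ 𝒮 from ⟨m', r'⟩))
    linarith
  have hd := hdef S ε mS rS hmin
  have h0 := hmin S0 mS0 rS0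
  rw [hWS0] at h0
  refine ⟨B \ S 0, Set.sdiff_subset, hB.diff (mS 0), ?_⟩
  have b1 : μ.real (B \ (B \ S 0)) ≤ μ.real (S 0) :=
    measureReal_mono (by intro x hx; by_contra h; exact hx.2 ⟨hx.1, h⟩) (measure_ne_top _ _)
  have b2 : μ.real ((A : Set G) ^ (p + 1) • (B \ S 0)) ≤ μ.real (S (p + 1)) + K * ε := by
    have hs : (A : Set G) • auxReach (A : Set G) B S p ⊆ S (p + 1) := by
      rw [auxReach] at rS
      exact Set.sdiff_eq_empty.1 rS
    have : (A : Set G) ^ (p + 1) • (B \ S 0) ⊆ S (p + 1) ∪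
        (((A : Set G) ^ (p + 1) • auxReach (A : Set G) B S 0) \
        ((A : Set G) • auxReach (A : Set G) B S p)) := by
      intro x hx
      by_cases h : x ∈ (A : Set G) • auxReach (A : Set G) B S p
      · exact Or.inl (hs h)
      · exact Or.inr ⟨hx, h⟩
    refine (measureReal_mono this (measure_ne_top _ _)).trans ?_
    exact (measureReal_union_le _ _).trans (by linarith)
  have b3 : μ.real (S 0) + w (p + 1) * μ.real (S (p + 1)) ≤ auxW μ w (p + 1) S := by
    unfold auxW
    rw [Finset.sum_range_succ, Finset.sum_range_succ', hw0, one_mul]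
    have : 0 ≤ ∑ i ∈ Finset.range p, w (i + 1) * μ.real (S (i + 1)) :=
      Finset.sum_nonneg fun i _ => mul_nonneg (hw _).le measureReal_nonneg
    linarith
  have b4 : ε + w (p + 1) * (K * ε) = η := by
    rw [hε]; field_simp
  nlinarith [mul_le_mul_of_nonneg_left b2 hwk.le]

end aux

/-- If a countable abelian group `G` acts on a probability space `(X, 𝓑, μ)` by measure
preserving maps, `A ⊆ G` is finite, `B` is measurable with `μ(B) > 0`, `0 < δ < 1` and
`j ≤ k` are positive integers, then
`c_δ(A^k, B)^(1/k) ≤ (1-δ)^(-1/j) (μ(A^j B)/μ(B))^(1/j)`. -/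
theorem magRatioHeavy_plunnecke {G X : Type*} [CommGroup G] [Countable G]
    [MulAction G X] [MeasurableSpace X] (μ : Measure X) [IsProbabilityMeasure μ]
    (hmeas : ∀ g : G, Measurable (fun x : X => g • x))
    (hinv : ∀ (g : G) (S : Set X), MeasurableSet S → μ (g • S) = μ S)
    (A : Set G) (hA : A.Finite) (B : Set X) (hB : MeasurableSet B) (hB0 : 0 < μ B)
    (δ : ℝ) (hδ0 : 0 < δ) (hδ1 : δ < 1) (j k : ℕ) (hj : 0 < j) (hjk : j ≤ k) :
    magRatioHeavy μ δ (A ^ k) B ^ (1 / (k : ℝ)) ≤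
      ENNReal.ofReal ((1 - δ) ^ (-(1 / (j : ℝ)))) *
        (μ ((A ^ j) • B) / μ B) ^ (1 / (j : ℝ)) := by
  have hk : 0 < k := lt_of_lt_of_le hj hjk
  have hb : 0 < μ.real B := ENNReal.toReal_pos hB0.ne' (measure_ne_top _ _)
  set a := μ.real (A ^ j • B) / μ.real B with ha
  have ha0 : 0 ≤ a := by positivity
  have hδ' : 0 < 1 - δ := by linarith
  have hrhs : ENNReal.ofReal ((1 - δ) ^ (-(1 / (j : ℝ)))) *
        (μ ((A ^ j) • B) / μ B) ^ (1 / (j : ℝ)) =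
        ENNReal.ofReal ((a / (1 - δ)) ^ (1 / (j : ℝ))) := by
    have : μ ((A ^ j) • B) / μ B = ENNReal.ofReal a := by
      rw [ha, ENNReal.ofReal_div_of_pos hb]
      simp [Measure.real]
    rw [this, ENNReal.ofReal_rpow_of_nonneg ha0 (by positivity),
      ← ENNReal.ofReal_mul (by positivity), Real.div_rpow ha0 hδ'.le, Real.rpow_neg hδ'.le]
    congr 1
    exact (div_eq_inv_mul _ _).symm
  rw [hrhs]
  -- it suffices to bound by every larger real `C`
  refine le_of_forall_gt_imp_ge_of_dense fun c hc => ?_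
  by_cases hctop : c = ⊤
  · simp [hctop]
  lift c to NNReal using hctop
  set C : ℝ := NNReal.toReal c with hC
  have hlt : (a / (1 - δ)) ^ (1 / (j : ℝ)) < C := by
    have := (ENNReal.ofReal_lt_iff_lt_toReal (by positivity) (by simp)).1 hc
    simpa using this
  have hC0 : 0 < C := lt_of_le_of_lt (by positivity) hlt
  have hlt' : a / (1 - δ) < C ^ j := by
    have h1 : ((a / (1 - δ)) ^ (1 / (j : ℝ))) ^ j < C ^ j :=
      pow_lt_pow_left₀ hlt (by positivity) hj.ne'
    rwa [one_div, Real.rpow_inv_natCast_pow (by positivity) hj.ne'] at h1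
  have hlt2 : (C⁻¹) ^ j * 1 ^ (j * (k - j)) * a < 1 - δ := by
    rw [div_lt_iff₀ hδ'] at hlt'
    rw [inv_pow, one_pow, mul_one, inv_mul_lt_iff₀ (by positivity)]
    exact hlt'
  obtain ⟨l, hl1, hl⟩ : ∃ l : ℝ, 1 < l ∧ (C⁻¹) ^ j * l ^ (j * (k - j)) * a < 1 - δ := by
    have hcont : Continuous (fun l : ℝ => (C⁻¹) ^ j * l ^ (j * (k - j)) * a) := by fun_prop
    have hev := (hcont.tendsto 1).eventually_lt_const hlt2
    have hev' : ∀ᶠ l in nhdsWithin (1 : ℝ) (Set.Ioi 1),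
        (C⁻¹) ^ j * l ^ (j * (k - j)) * a < 1 - δ := hev.filter_mono nhdsWithin_le_nhds
    obtain ⟨l, h1, h2⟩ := (hev'.and self_mem_nhdsWithin).exists
    exact ⟨l, h2, h1⟩
  have hl0 : 0 < l := by linarith
  let w : ℕ → ℝ := fun i => (C⁻¹) ^ i * l ^ (i * (k - i))
  have hw : ∀ i, 0 < w i := fun i => by positivity
  have hlog : ∀ n, n + 2 ≤ k → w n * w (n + 2) < w (n + 1) ^ 2 := by
    intro n hn
    obtain ⟨r, rfl⟩ := Nat.exists_eq_add_of_le hn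
    have e0 : n + 2 + r - n = r + 2 := by omega
    have e1 : n + 2 + r - (n + 1) = r + 1 := by omega
    have e2 : n + 2 + r - (n + 2) = r := by omega
    simp only [w, e0, e1, e2]
    have h1 : (C⁻¹) ^ n * l ^ (n * (r + 2)) * ((C⁻¹) ^ (n + 2) * l ^ ((n + 2) * r)) =
        (C⁻¹) ^ (2 * n + 2) * l ^ (2 * n * r + 2 * n + 2 * r) := by ring
    have h2 : ((C⁻¹) ^ (n + 1) * l ^ ((n + 1) * (r + 1))) ^ 2 =
        (C⁻¹) ^ (2 * n + 2) * l ^ (2 * n * r + 2 * n + 2 * r + 2) := by ring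
    rw [h1, h2]
    have : l ^ (2 * n * r + 2 * n + 2 * r) < l ^ (2 * n * r + 2 * n + 2 * r + 2) :=
      pow_lt_pow_right₀ hl1 (by omega)
    have hp : 0 < (C⁻¹) ^ (2 * n + 2) := by positivity
    exact mul_lt_mul_of_pos_left this hp
  have hη : 0 < (1 - δ - w j * a) * μ.real B := mul_pos (sub_pos.2 hl) hb
  obtain ⟨T, hTB, mT, hT⟩ := aux_core μ hmeas hinv hA.toFinset B hB w j k hj hjk
    (by simp [w]) hw hlog _ hη
  rw [hA.coe_toFinset, measureReal_sdiff hTB mT] at hT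
  have hab : μ.real (A ^ j • B) = a * μ.real B := by rw [ha]; field_simp
  have hwk : w k = (C ^ k)⁻¹ := by simp [w]
  rw [hab, hwk] at hT
  have hT' : (C ^ k)⁻¹ * μ.real (A ^ k • T) ≤ μ.real T - δ * μ.real B := by nlinarith
  have hnn : 0 ≤ (C ^ k)⁻¹ * μ.real (A ^ k • T) := by positivity
  have hδb : 0 < δ * μ.real B := by positivity
  have hTpos : 0 < μ.real T := by linarith
  have hfin : μ.real (A ^ k • T) / μ.real T ≤ C ^ k := by
    rw [div_le_iff₀ hTpos]
    have : (C ^ k)⁻¹ * μ.real (A ^ k • T) ≤ μ.real T := by linarith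
    rwa [inv_mul_le_iff₀ (by positivity)] at this
  have hmag : magRatioHeavy μ δ (A ^ k) B ≤ ENNReal.ofReal (C ^ k) := by
    unfold magRatioHeavy
    refine sInf_le_of_le (b := μ (A ^ k • T) / μ T) ⟨T, hTB, mT, ?_, rfl⟩ ?_
    · rw [← ofReal_measureReal (μ := μ) (s := B), ← ofReal_measureReal (μ := μ) (s := T),
        ← ENNReal.ofReal_mul hδ0.le]
      exact ENNReal.ofReal_le_ofReal (by linarith)
    · refine le_trans (le_of_eq ?_) (ENNReal.ofReal_le_ofReal hfin)
      rw [ENNReal.ofReal_div_of_pos hTpos, ofReal_measureReal, ofReal_measureReal]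
  calc magRatioHeavy μ δ (A ^ k) B ^ (1 / (k : ℝ))
      ≤ (ENNReal.ofReal (C ^ k)) ^ (1 / (k : ℝ)) := ENNReal.rpow_le_rpow hmag (by positivity)
    _ = ENNReal.ofReal C := by
        rw [ENNReal.ofReal_rpow_of_nonneg (by positivity) (by positivity), one_div,
          Real.pow_rpow_inv_natCast hC0.le hk.ne']
    _ = (c : ℝ≥0∞) := by rw [hC]; exact ENNReal.ofReal_coe_nnreal
end

section
/- Let G be a countable abelian group acting on a probability space (X, 𝓑, μ), let A ⊆ G be finite, let B ∈ 𝓑 with μ(B) > 0, let 0 < δ < 1, and let j ≤ k be positive integers. Suppose B′ ⊆ B is measurable with μ(B′) > 0 and satisfies (μ(A^k B′)/μ(B′))^{1/k} ≤ (1-δ)^{-1/j} · (μ(A^j B)/μ(B))^{1/j}. Then either μ(B′) ≥ δ·μ(B), or there exists a measurable B″ with B′ ⊆ B″ ⊆ B, μ(B″ \ B′) > 0, and (μ(A^k B″)/μ(B″))^{1/k} ≤ (1-δ)^{-1/j} · (μ(A^j B)/μ(B))^{1/j}. -/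
open Filter MeasureTheory Pointwise ENNReal

namespace HeavySet

/-- Layer-cake identity for a finite family of sets. -/
lemma layer {ι X : Type*} [MeasurableSpace X] (μ : Measure X) [IsFiniteMeasure μ]
    (s : Finset ι) (E : ι → Set X) (hE : ∀ b ∈ s, MeasurableSet (E b)) :
    (∀ m : ℕ, MeasurableSet {x | m < ∑ b ∈ s, (E b).indicator (fun _ => (1 : ℕ)) x}) ∧
    ∑ m ∈ Finset.range s.card,
      μ.real {x | m < ∑ b ∈ s, (E b).indicator (fun _ => (1 : ℕ)) x}
      = ∑ b ∈ s, μ.real (E b) := by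
  have hf : Measurable (fun x => ∑ b ∈ s, (E b).indicator (fun _ => (1 : ℕ)) x) :=
    Finset.measurable_fun_sum s fun b hb => measurable_const.indicator (hE b hb)
  have hM : ∀ m : ℕ, MeasurableSet {x | m < ∑ b ∈ s, (E b).indicator (fun _ => (1 : ℕ)) x} :=
    fun m => measurableSet_lt measurable_const hf
  refine ⟨hM, ?_⟩
  have h1 : ∀ m : ℕ, μ.real {x | m < ∑ b ∈ s, (E b).indicator (fun _ => (1 : ℕ)) x}
      = ∫ x, {x | m < ∑ b ∈ s, (E b).indicator (fun _ => (1 : ℕ)) x}.indicator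
          (fun _ => (1 : ℝ)) x ∂μ := by
    intro m
    rw [integral_indicator (hM m)]; simp
  have h2 : ∀ b ∈ s, μ.real (E b) = ∫ x, (E b).indicator (fun _ => (1 : ℝ)) x ∂μ := by
    intro b hb
    rw [integral_indicator (hE b hb)]; simp
  rw [Finset.sum_congr rfl (fun m _ => h1 m), Finset.sum_congr rfl h2,
    ← integral_finsetSum, ← integral_finsetSum]
  · congr 1
    ext x
    have hle : ∑ b ∈ s, (E b).indicator (fun _ => (1 : ℕ)) x ≤ s.card := by
      rw [Finset.card_eq_sum_ones]
      refine Finset.sum_le_sum fun b _ => ?_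
      by_cases hx : x ∈ E b <;> simp [hx]
    have hc : ∑ b ∈ s, (E b).indicator (fun _ => (1 : ℝ)) x
        = ((∑ b ∈ s, (E b).indicator (fun _ => (1 : ℕ)) x : ℕ) : ℝ) := by
      push_cast
      refine Finset.sum_congr rfl fun b _ => ?_
      by_cases hx : x ∈ E b <;> simp [hx]
    rw [hc]
    have : ∀ m, ({x_1 : X | m < ∑ b ∈ s, (E b).indicator (fun _ => (1 : ℕ)) x_1}.indicator
          (fun _ => (1 : ℝ)) x) = if m < ∑ b ∈ s, (E b).indicator (fun _ => (1 : ℕ)) x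
            then (1:ℝ) else 0 := fun m => by
      simp [Set.indicator_apply]
    rw [Finset.sum_congr rfl fun m _ => this m]
    generalize ∑ b ∈ s, (E b).indicator (fun _ => (1 : ℕ)) x = d at hle ⊢
    rw [Finset.sum_ite, Finset.sum_const_zero, add_zero, Finset.sum_const, nsmul_eq_mul, mul_one]
    congr 1
    have : (Finset.range s.card).filter (fun m => m < d) = Finset.range d := by
      ext m; simp; omega
    rw [this, Finset.card_range]
  · intro b hb
    exact (integrable_const _).indicator (hE b hb)
  · intro m _
    exact (integrable_const _).indicator (hM m)

section
set_option linter.unusedSectionVars false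
variable {G X : Type*} [CommGroup G] [Countable G] [MulAction G X] [MeasurableSpace X]

lemma meas_gsmul (hmeas : ∀ g : G, Measurable (fun x : X => g • x)) (g : G) {S : Set X}
    (hS : MeasurableSet S) : MeasurableSet (g • S) := by
  rw [← Set.preimage_smul_inv]
  exact hmeas g⁻¹ hS

lemma meas_smul (hmeas : ∀ g : G, Measurable (fun x : X => g • x)) (A : Set G) {S : Set X}
    (hS : MeasurableSet S) : MeasurableSet (A • S) := by
  rw [← Set.iUnion_smul_set]
  exact MeasurableSet.biUnion (Set.to_countable A) fun g _ => meas_gsmul hmeas g hS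

/-- number of forward labelled edges. -/
noncomputable def degF (A : Finset G) (U S : Set X) (x : X) : ℕ :=
  ∑ b ∈ A, ({y | y ∈ U ∧ b • y ∈ S} : Set X).indicator (fun _ => (1 : ℕ)) x

/-- number of backward labelled edges. -/
noncomputable def degB (A : Finset G) (U S : Set X) (x : X) : ℕ :=
  ∑ b ∈ A, ({y | y ∈ S ∧ b⁻¹ • y ∈ U} : Set X).indicator (fun _ => (1 : ℕ)) x

lemma degs (μ : Measure X) [IsFiniteMeasure μ]
    (hmeas : ∀ g : G, Measurable (fun x : X => g • x))
    (hinv : ∀ (g : G) (S : Set X), MeasurableSet S → μ (g • S) = μ S)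
    (A : Finset G) {U S : Set X} (hU : MeasurableSet U) (hS : MeasurableSet S) :
    (∀ m, MeasurableSet {x | m < degF A U S x}) ∧ (∀ m, MeasurableSet {x | m < degB A U S x}) ∧
    ∑ m ∈ Finset.range A.card, μ.real {x | m < degF A U S x}
      = ∑ m ∈ Finset.range A.card, μ.real {x | m < degB A U S x} := by
  have e1 : ∀ b ∈ A, MeasurableSet ({y | y ∈ U ∧ b • y ∈ S} : Set X) :=
    fun b _ => hU.inter (hmeas b hS)
  have e2 : ∀ b ∈ A, MeasurableSet ({y | y ∈ S ∧ b⁻¹ • y ∈ U} : Set X) :=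
    fun b _ => hS.inter (hmeas b⁻¹ hU)
  have l1 := layer μ A _ e1
  have l2 := layer μ A _ e2
  refine ⟨l1.1, l2.1, ?_⟩
  refine l1.2.trans (Eq.trans ?_ l2.2.symm)
  refine Finset.sum_congr rfl fun b hb => ?_
  have : ({y | y ∈ S ∧ b⁻¹ • y ∈ U} : Set X) = b • ({y | y ∈ U ∧ b • y ∈ S} : Set X) := by
    ext y
    simp [Set.mem_smul_set_iff_inv_smul_mem, and_comm]
  rw [this, measureReal_def, measureReal_def, hinv b _ (e1 b hb)]

/-- The key local inequality. -/
lemma local_ineq (μ : Measure X) [IsFiniteMeasure μ]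
    (hmeas : ∀ g : G, Measurable (fun x : X => g • x))
    (hinv : ∀ (g : G) (S : Set X), MeasurableSet S → μ (g • S) = μ S)
    (A : Finset G) {U S Q : Set X} (hU : MeasurableSet U) (hS : MeasurableSet S)
    (hQ : MeasurableSet Q) (C ε : ℝ) (hC : 0 ≤ C) (hε : 0 ≤ ε)
    (hcomm : ∀ a ∈ A, ∀ b ∈ A, ∀ u ∈ U, a • u ∈ S → b • a • u ∉ Q → b • u ∈ S)
    (hdown : ∀ Y ⊆ S, MeasurableSet Y →
      μ.real Y ≤ C * μ.real {x | x ∈ U ∧ ∃ a ∈ A, a • x ∈ Y} + ε)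
    (hup : ∀ Y ⊆ S, MeasurableSet Y → C * μ.real Y ≤ μ.real (((A : Set G) • Y) \ Q) + ε) :
    μ.real (((A : Set G) • S) \ Q) ≤ C * μ.real S + 2 * A.card * ε := by
  obtain ⟨mX, mZ, hXZ⟩ := degs μ hmeas hinv A hU hS
  obtain ⟨mY, mT, hYT⟩ := degs μ hmeas hinv A hS hQ.compl
  have hXY : ∀ m, μ.real {x | m < degF A S Qᶜ x} ≤ C * μ.real {x | m < degF A U S x} + ε := by
    intro m
    refine (hdown _ ?_ (mY m)).trans ?_
    · intro x hx
      by_contra hxS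
      simp [degF, hxS] at hx
    · gcongr
      · exact measure_ne_top _ _
      rename_i x
      rintro ⟨hxU, a, ha, hx⟩
      refine lt_of_lt_of_le (Set.mem_ofPred_eq ▸ hx) ?_
      refine Finset.sum_le_sum fun b hb => ?_
      refine Set.indicator_apply_le' ?_ ?_ 
      · rintro ⟨h1, h2⟩
        rw [Set.indicator_of_mem]
        exact ⟨hxU, hcomm a ha b hb x hxU h1 h2⟩
      · intro _; positivity
  have hZT : ∀ m, C * μ.real {x | m < degB A U S x} ≤ μ.real {x | m < degB A S Qᶜ x} + ε := by
    intro m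
    refine (hup _ ?_ (mZ m)).trans ?_
    · intro x hx
      by_contra hxS
      simp [degB, hxS] at hx
    · gcongr
      · exact measure_ne_top _ _
      rintro x ⟨hx, hxQ⟩
      obtain ⟨b, hb, s, hs, rfl⟩ := Set.mem_smul.1 hx
      refine lt_of_lt_of_le (Set.mem_ofPred_eq ▸ hs) ?_
      refine Finset.sum_le_sum fun a ha => ?_
      refine Set.indicator_apply_le' ?_ ?_
      · rintro ⟨h1, h2⟩
        rw [Set.indicator_of_mem]
        refine ⟨hxQ, ?_⟩
        have := hcomm a ha b hb (a⁻¹ • s) h2 (by simpa using h1) (by simpa using hxQ)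
        rwa [smul_comm] at this
      · intro _; positivity
  by_cases hA : A.card = 0
  · have : A = ∅ := Finset.card_eq_zero.1 hA
    subst this
    simp
    positivity
  have h0 : 0 ∈ Finset.range A.card := Finset.mem_range.2 (Nat.pos_of_ne_zero hA)
  have hT : μ.real (((A : Set G) • S) \ Q) ≤ μ.real {x | 0 < degB A S Qᶜ x} := by
    refine measureReal_mono ?_ (measure_ne_top _ _)
    rintro x ⟨hx, hxQ⟩
    obtain ⟨b, hb, s, hs, rfl⟩ := Set.mem_smul.1 hx
    refine Finset.sum_pos' (fun _ _ => Nat.zero_le _) ⟨b, hb, ?_⟩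
    rw [Set.indicator_of_mem]
    · exact one_pos
    · exact ⟨hxQ, by simpa using hs⟩
  have hZ : μ.real {x | 0 < degB A U S x} ≤ μ.real S := by
    refine measureReal_mono ?_ (measure_ne_top _ _)
    intro x hx
    by_contra hxS
    simp [degB, hxS] at hx
  have hs1 : ∑ m ∈ Finset.range A.card, μ.real {x | m < degF A S Qᶜ x} ≤
      C * ∑ m ∈ Finset.range A.card, μ.real {x | m < degF A U S x} + A.card * ε := by
    refine (Finset.sum_le_sum fun m _ => hXY m).trans ?_
    simp [Finset.sum_add_distrib, Finset.mul_sum]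
  have hs2 : μ.real {x | 0 < degB A S Qᶜ x} - C * μ.real {x | 0 < degB A U S x} + ε ≤
      ∑ m ∈ Finset.range A.card, (μ.real {x | m < degB A S Qᶜ x}
        - C * μ.real {x | m < degB A U S x} + ε) :=
    Finset.single_le_sum (f := fun m => (μ.real {x | m < degB A S Qᶜ x}
        - C * μ.real {x | m < degB A U S x} + ε)) (fun m _ => by linarith [hZT m]) h0
  simp only [Finset.sum_add_distrib, Finset.sum_sub_distrib, ← Finset.mul_sum,
    Finset.sum_const, Finset.card_range, nsmul_eq_mul] at hs2
  rw [hXZ, hYT] at hs1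
  have := mul_le_mul_of_nonneg_left hZ hC
  linarith

/-- candidate layer. -/
def lay (A : Set G) (B : Set X) (U : ℕ → Set X) : ℕ → Set X
  | 0 => B
  | i + 1 => A • U i

/-- cut weight. -/
noncomputable def W (μ : Measure X) (A : Set G) (B : Set X) (c : ℝ) (k : ℕ) (U : ℕ → Set X) : ℝ :=
  ∑ i ∈ Finset.range (k + 1), c ^ i * μ.real (lay A B U i \ U i)

lemma W_update (μ : Measure X) (A : Set G) (B : Set X) (c : ℝ) (k : ℕ) (U : ℕ → Set X)
    (i : ℕ) (hi : i < k) (V : Set X) :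
    W μ A B c k (Function.update U i V) = W μ A B c k U
      + c ^ i * (μ.real (lay A B U i \ V) - μ.real (lay A B U i \ U i))
      + c ^ (i + 1) * (μ.real ((A • V) \ U (i + 1)) - μ.real ((A • U i) \ U (i + 1))) := by
  have key : ∀ l ∈ Finset.range (k + 1),
      c ^ l * μ.real (lay A B (Function.update U i V) l \ Function.update U i V l)
      = c ^ l * μ.real (lay A B U l \ U l)
      + (if l = i then c ^ i * (μ.real (lay A B U i \ V) - μ.real (lay A B U i \ U i)) else 0)
      + (if l = i + 1 then c ^ (i + 1) *
        (μ.real ((A • V) \ U (i + 1)) - μ.real ((A • U i) \ U (i + 1))) else 0) := by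
    intro l _
    rcases eq_or_ne l i with rfl | h1
    · have : lay A B (Function.update U l V) l = lay A B U l := by
        cases l <;> simp [lay]
      rw [this]; simp; ring
    · rcases eq_or_ne l (i + 1) with rfl | h2
      · simp [lay]; ring
      · have : lay A B (Function.update U i V) l = lay A B U l := by
          cases l with
          | zero => simp [lay]
          | succ n =>
            have : n ≠ i := by omega
            simp [lay, this]
        rw [this]; simp [h1, h2]
  rw [W, Finset.sum_congr rfl key, Finset.sum_add_distrib, Finset.sum_add_distrib,
    Finset.sum_ite_eq', Finset.sum_ite_eq', if_pos (by simp; omega), if_pos (by simp; omega), W]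

/-- admissible sequences -/
def Adm (k : ℕ) (U : ℕ → Set X) : Prop := (∀ i, MeasurableSet (U i)) ∧ U k = ∅

lemma Adm.update {k : ℕ} {U : ℕ → Set X} (h : Adm k U) {i : ℕ} (hi : i < k) {V : Set X}
    (hV : MeasurableSet V) : Adm k (Function.update U i V) := by
  refine ⟨fun l => ?_, ?_⟩
  · rcases eq_or_ne l i with rfl | h1
    · simpa using hV
    · simpa [h1] using h.1 l
  · rw [Function.update_of_ne (by omega)]; exact h.2

lemma step (μ : Measure X) [IsFiniteMeasure μ]
    (hmeas : ∀ g : G, Measurable (fun x : X => g • x))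
    (hinv : ∀ (g : G) (S : Set X), MeasurableSet S → μ (g • S) = μ S)
    (A : Finset G) (B : Set X) (hB : MeasurableSet B) (C : ℝ) (hC : 0 < C) (k : ℕ) (I : ℝ)
    (hI : ∀ U, Adm k U → I ≤ W μ (A : Set G) B C⁻¹ k U) (i : ℕ) (hi : i + 1 < k)
    (ε : ℝ) (hε : 0 ≤ ε) (U : ℕ → Set X) (hU : Adm k U) (hW : W μ (A : Set G) B C⁻¹ k U ≤ I + ε) :
    W μ (A : Set G) B C⁻¹ k (Function.update U (i + 1) (U (i + 1) ∪ (A : Set G) • U i)) ≤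
      I + (1 + 2 * A.card * ((1 + C) / C)) * ε := by
  have hc : 0 < C⁻¹ := by positivity
  have hD : 0 < C⁻¹ ^ (i + 1) := by positivity
  set D := C⁻¹ ^ (i + 1) with hDdef
  have hD1 : C⁻¹ ^ i = C * D := by rw [hDdef, pow_succ]; field_simp
  have hD2 : C⁻¹ ^ (i + 1 + 1) = D / C := by rw [hDdef, pow_succ _ (i+1)]; field_simp
  have mA : ∀ {S : Set X}, MeasurableSet S → MeasurableSet ((A : Set G) • S) :=
    fun h => meas_smul hmeas _ h
  have hS : MeasurableSet (((A : Set G) • U i) \ U (i + 1)) := (mA (hU.1 i)).diff (hU.1 _)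
  have hloc := local_ineq μ hmeas hinv A (U := U i) (S := ((A : Set G) • U i) \ U (i + 1))
    (Q := (A : Set G) • U (i + 1)) (hU.1 i) hS (mA (hU.1 _)) C ((1 + C) / D * ε) hC.le
    (by positivity) ?_ ?_ ?_
  · rw [W_update _ _ _ _ _ _ _ hi, hD2]
    have e1 : lay (A : Set G) B U (i + 1) \ (U (i + 1) ∪ (A : Set G) • U i) = ∅ := by
      simp [lay, Set.sdiff_eq_empty]
    have e2 : μ.real (((A : Set G) • (U (i + 1) ∪ (A : Set G) • U i)) \ U (i + 1 + 1)) ≤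
        μ.real (((A : Set G) • U (i + 1)) \ U (i + 1 + 1)) +
        μ.real (((A : Set G) • (((A : Set G) • U i) \ U (i + 1))) \ ((A : Set G) • U (i + 1))) := by
      refine (measureReal_mono ?_ (measure_ne_top _ _)).trans (measureReal_union_le _ _)
      rw [← Set.union_sdiff_self, Set.smul_union]
      rintro x ⟨hx, hx2⟩
      by_cases hx3 : x ∈ (A : Set G) • U (i + 1)
      · exact Or.inl ⟨hx3, hx2⟩
      · exact Or.inr ⟨hx.resolve_left hx3, hx3⟩
    rw [e1, ← hDdef]
    simp only [measureReal_empty, lay]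
    have e3 := mul_le_mul_of_nonneg_left (e2.trans (add_le_add_right hloc _)) (a := D / C) (by positivity)
    have e4 : D / C * (C * μ.real (((A : Set G) • U i) \ U (i + 1)) +
        2 * A.card * ((1 + C) / D * ε)) = D * μ.real (((A : Set G) • U i) \ U (i + 1)) +
        2 * A.card * ((1 + C) / C) * ε := by field_simp
    rw [mul_add (D / C) (μ.real _), e4] at e3
    linarith
  · intro a ha b hb u hu h1 h2
    refine ⟨Set.smul_mem_smul hb hu, fun h3 => h2 ?_⟩
    rw [smul_comm]
    exact Set.smul_mem_smul ha h3
  · intro Y hY mY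
    have hV : MeasurableSet {x | x ∈ U i ∧ ∃ a ∈ A, a • x ∈ Y} := by
      have : {x | x ∈ U i ∧ ∃ a ∈ A, a • x ∈ Y} = U i ∩ ⋃ a ∈ A, (fun x => a • x) ⁻¹' Y := by
        ext; simp
      rw [this]
      exact (hU.1 i).inter (Finset.measurableSet_biUnion _ fun a _ => hmeas a mY)
    set V := {x | x ∈ U i ∧ ∃ a ∈ A, a • x ∈ Y} with hVdef
    have h := hI _ (hU.update (i := i) (by omega) ((hU.1 i).diff hV))
    rw [W_update _ _ _ _ _ _ _ (by omega), ← hDdef, hD1] at h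
    have e1 : μ.real (lay (A : Set G) B U i \ (U i \ V)) ≤
        μ.real (lay (A : Set G) B U i \ U i) + μ.real V := by
      refine (measureReal_mono ?_ (measure_ne_top _ _)).trans (measureReal_union_le _ _)
      rintro x ⟨hx, hx2⟩
      by_cases hx3 : x ∈ U i
      · exact Or.inr (by_contra fun h => hx2 ⟨hx3, h⟩)
      · exact Or.inl ⟨hx, hx3⟩
    have e2 : μ.real (((A : Set G) • (U i \ V)) \ U (i + 1)) + μ.real Y ≤
        μ.real (((A : Set G) • U i) \ U (i + 1)) := by
      rw [← measureReal_union _ mY]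
      · refine measureReal_mono ?_ (measure_ne_top _ _)
        refine Set.union_subset ?_ hY
        exact Set.sdiff_subset_sdiff_left (Set.smul_subset_smul_left Set.sdiff_subset)
      · rw [Set.disjoint_left]
        rintro x ⟨hx, -⟩ hxY
        obtain ⟨a, ha, u, hu, rfl⟩ := Set.mem_smul.1 hx
        exact hu.2 ⟨hu.1, a, ha, hxY⟩
    have h1 := mul_le_mul_of_nonneg_left e1 (a := C * D) (by positivity)
    have h2 := mul_le_mul_of_nonneg_left e2 hD.le
    have h3 : μ.real Y * D ≤ (C * μ.real V) * D + ε := by linarith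
    have h4 : (1 + C) / D * ε * D = ε + C * ε := by field_simp
    have h5 : 0 ≤ C * ε := by positivity
    refine le_of_mul_le_mul_right ?_ hD
    rw [add_mul, h4]
    linarith
  · intro Y hY mY
    have h := hI _ (hU.update (i := i + 1) hi ((hU.1 (i + 1)).union mY))
    rw [W_update _ _ _ _ _ _ _ hi, ← hDdef, hD2] at h
    have e1 : μ.real (lay (A : Set G) B U (i + 1) \ (U (i + 1) ∪ Y)) + μ.real Y ≤
        μ.real (lay (A : Set G) B U (i + 1) \ U (i + 1)) := by
      rw [← measureReal_union _ mY]
      · refine measureReal_mono ?_ (measure_ne_top _ _)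
        refine Set.union_subset ?_ hY
        exact Set.sdiff_subset_sdiff_right Set.subset_union_left
      · rw [Set.disjoint_left]
        rintro x ⟨hx, h⟩ hxY
        exact h (Or.inr hxY)
    have e2 : μ.real (((A : Set G) • (U (i + 1) ∪ Y)) \ U (i + 1 + 1)) ≤
        μ.real (((A : Set G) • U (i + 1)) \ U (i + 1 + 1)) +
        μ.real (((A : Set G) • Y) \ ((A : Set G) • U (i + 1))) := by
      refine (measureReal_mono ?_ (measure_ne_top _ _)).trans (measureReal_union_le _ _)
      rw [Set.smul_union]
      rintro x ⟨hx, hx2⟩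
      by_cases hx3 : x ∈ (A : Set G) • U (i + 1)
      · exact Or.inl ⟨hx3, hx2⟩
      · exact Or.inr ⟨hx.resolve_left hx3, hx3⟩
    have h1 := mul_le_mul_of_nonneg_left e1 hD.le
    have h2 := mul_le_mul_of_nonneg_left e2 (a := D / C) (by positivity)
    have h3 : D * μ.real Y ≤ D / C * μ.real (((A : Set G) • Y) \ ((A : Set G) • U (i + 1))) + ε := by
      linarith
    refine le_of_mul_le_mul_left ?_ (show 0 < D / C by positivity)
    have h4 : D / C * (C * μ.real Y) = D * μ.real Y := by field_simp
    have h5 : D / C * ((1 + C) / D * ε) = ε + ε / C := by field_simp; ring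
    have h6 : 0 ≤ ε / C := by positivity
    rw [mul_add, h4, h5]
    linarith

/-- Measurable Pluennecke inequality. -/
lemma pluennecke (μ : Measure X) [IsFiniteMeasure μ]
    (hmeas : ∀ g : G, Measurable (fun x : X => g • x))
    (hinv : ∀ (g : G) (S : Set X), MeasurableSet S → μ (g • S) = μ S)
    (A : Finset G) (B : Set X) (hB : MeasurableSet B) (C : ℝ) (hC : 0 < C) (j k : ℕ)
    (hj : 0 < j) (hjk : j ≤ k)
    (hZ : ∀ Z ⊆ B, MeasurableSet Z → C ^ k * μ.real Z ≤ μ.real (((A : Set G) ^ k) • Z)) :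
    C ^ j * μ.real B ≤ μ.real (((A : Set G) ^ j) • B) := by
  have hc : 0 < C⁻¹ := by positivity
  have mA : ∀ {S : Set X}, MeasurableSet S → MeasurableSet ((A : Set G) • S) :=
    fun h => meas_smul hmeas _ h
  have hnn : ∀ U, 0 ≤ W μ (A : Set G) B C⁻¹ k U := fun U =>
    Finset.sum_nonneg fun i _ => by positivity
  set T : Set ℝ := {r | ∃ U, Adm k U ∧ W μ (A : Set G) B C⁻¹ k U = r} with hT
  have hTb : BddBelow T := ⟨0, by rintro _ ⟨U, _, rfl⟩; exact hnn U⟩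
  have hTn : T.Nonempty := ⟨_, fun _ => ∅, ⟨fun _ => MeasurableSet.empty, rfl⟩, rfl⟩
  have hI : ∀ U, Adm k U → sInf T ≤ W μ (A : Set G) B C⁻¹ k U :=
    fun U hU => csInf_le hTb ⟨U, hU, rfl⟩
  have main : ∀ i, i < k → ∀ ε > 0, ∃ U, Adm k U ∧ W μ (A : Set G) B C⁻¹ k U ≤ sInf T + ε ∧
      ∀ l < i, (A : Set G) • U l ⊆ U (l + 1) := by
    intro i
    induction i with
    | zero =>
      intro _ ε hε
      obtain ⟨_, ⟨U, hU, rfl⟩, h⟩ := exists_lt_of_csInf_lt hTn (lt_add_of_pos_right (sInf T) hε)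
      exact ⟨U, hU, h.le, by simp⟩
    | succ i ih =>
      intro hi ε hε
      have hK : 0 < 1 + 2 * A.card * ((1 + C) / C) := by positivity
      obtain ⟨U, hU, hW, hl⟩ := ih (by omega) (ε / (1 + 2 * A.card * ((1 + C) / C))) (by positivity)
      refine ⟨_, hU.update hi ((hU.1 (i + 1)).union (mA (hU.1 i))),
        (step μ hmeas hinv A B hB C hC k _ hI i hi _ (by positivity) U hU hW).trans
          (by rw [mul_div_cancel₀ _ hK.ne']), ?_⟩
      intro l hlt
      rw [Function.update_of_ne (by omega)]
      rcases eq_or_ne l i with rfl | hne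
      · simp
      · rw [Function.update_of_ne (by omega)]
        exact hl l (by omega)
  have low : μ.real B ≤ sInf T := by
    refine le_of_forall_pos_le_add fun ε hε => ?_
    obtain ⟨U, hU, hW, hl⟩ := main (k - 1) (by omega) ε hε
    refine le_trans ?_ hW
    have hsub : ∀ l < k, ((A : Set G) ^ l) • U 0 ⊆ U l := by
      intro l
      induction l with
      | zero => intro _; simp
      | succ l ih =>
        intro h
        rw [pow_succ', mul_smul]
        exact (Set.smul_subset_smul_left (ih (by omega))).trans (hl l (by omega))
    obtain ⟨k', rfl⟩ : ∃ k', k = k' + 1 := ⟨k - 1, by omega⟩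
    have h1 : μ.real (B \ U 0) + C⁻¹ ^ (k' + 1) * μ.real ((A : Set G) • U k') ≤
        W μ (A : Set G) B C⁻¹ (k' + 1) U := by
      rw [W, Finset.sum_range_succ, Finset.sum_range_succ', hU.2]
      simp only [lay, pow_zero, one_mul, Set.sdiff_empty]
      have : 0 ≤ ∑ i ∈ Finset.range k', C⁻¹ ^ (i + 1) *
        μ.real (((A : Set G) • U i) \ U (i + 1)) := Finset.sum_nonneg fun i _ => by positivity
      linarith
    refine le_trans ?_ h1
    have h2 := hZ (B ∩ U 0) Set.inter_subset_left (hB.inter (hU.1 0))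
    have h3 : μ.real (((A : Set G) ^ (k' + 1)) • (B ∩ U 0)) ≤ μ.real ((A : Set G) • U k') := by
      refine measureReal_mono ?_ (measure_ne_top _ _)
      rw [pow_succ', mul_smul]
      exact Set.smul_subset_smul_left
        ((Set.smul_subset_smul_left Set.inter_subset_right).trans (hsub k' (by omega)))
    have h4 : μ.real (B ∩ U 0) ≤ C⁻¹ ^ (k' + 1) * μ.real ((A : Set G) • U k') := by
      rw [inv_pow, inv_mul_eq_div, le_div_iff₀ (by positivity)]
      linarith
    have h5 := measureReal_sdiff_add_inter (μ := μ) (s := B) (hU.1 0)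
    linarith
  have hA' : ∀ i, MeasurableSet (((A : Set G) ^ i) • B) := fun i => meas_smul hmeas _ hB
  have hup := hI (fun i => if i < j then ((A : Set G) ^ i) • B else ∅)
    ⟨fun i => by dsimp only; split_ifs; exacts [hA' i, MeasurableSet.empty], by
      simp; omega⟩
  have hval : W μ (A : Set G) B C⁻¹ k (fun i => if i < j then ((A : Set G) ^ i) • B else ∅)
      = C⁻¹ ^ j * μ.real (((A : Set G) ^ j) • B) := by
    rw [W, Finset.sum_eq_single j]
    · obtain ⟨j', rfl⟩ : ∃ j', j = j' + 1 := ⟨j - 1, by omega⟩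
      simp [lay, pow_succ', mul_smul]
    · intro i _ hij
      rcases Nat.lt_or_ge i j with h | h
      · cases i with
        | zero => simp [lay, h]
        | succ i =>
          have : i < j := by omega
          simp [lay, h, this, pow_succ', mul_smul]
      · cases i with
        | zero => omega
        | succ i =>
          have : ¬ i < j := by omega
          simp [lay, this]
    · intro h; simp at h; omega
  rw [hval] at hup
  have := low.trans hup
  rw [inv_pow, inv_mul_eq_div, le_div_iff₀ (by positivity)] at this
  linarith

end

end HeavySet



/-- If a countable abelian group `G` acts on a probability space `(X, 𝓑, μ)` by measure
preserving maps, `A ⊆ G` is finite, `B` is measurable with `μ(B) > 0`, `0 < δ < 1`,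
`j ≤ k` are positive integers and `B' ⊆ B` is measurable with `μ(B') > 0` satisfying
`(μ(A^k B')/μ(B'))^(1/k) ≤ (1-δ)^(-1/j) (μ(A^j B)/μ(B))^(1/j)`, then either
`μ(B') ≥ δ·μ(B)` or there is a measurable `B''` with `B' ⊆ B'' ⊆ B`, `μ(B'' \ B') > 0`
satisfying the same inequality. -/
theorem heavy_set_or_extend {G X : Type*} [CommGroup G] [Countable G]
    [MulAction G X] [MeasurableSpace X] (μ : Measure X) [IsProbabilityMeasure μ]
    (hmeas : ∀ g : G, Measurable (fun x : X => g • x))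
    (hinv : ∀ (g : G) (S : Set X), MeasurableSet S → μ (g • S) = μ S)
    (A : Set G) (hA : A.Finite) (B : Set X) (hB : MeasurableSet B) (hB0 : 0 < μ B)
    (δ : ℝ) (hδ0 : 0 < δ) (hδ1 : δ < 1) (j k : ℕ) (hj : 0 < j) (hjk : j ≤ k)
    (B' : Set X) (hB' : B' ⊆ B) (hB'meas : MeasurableSet B') (hB'0 : 0 < μ B')
    (hineq : (μ ((A ^ k) • B') / μ B') ^ (1 / (k : ℝ)) ≤
      ENNReal.ofReal ((1 - δ) ^ (-(1 / (j : ℝ)))) *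
        (μ ((A ^ j) • B) / μ B) ^ (1 / (j : ℝ))) :
    ENNReal.ofReal δ * μ B ≤ μ B' ∨
      ∃ B'' : Set X, MeasurableSet B'' ∧ B' ⊆ B'' ∧ B'' ⊆ B ∧ 0 < μ (B'' \ B') ∧
        (μ ((A ^ k) • B'') / μ B'') ^ (1 / (k : ℝ)) ≤
          ENNReal.ofReal ((1 - δ) ^ (-(1 / (j : ℝ)))) *
            (μ ((A ^ j) • B) / μ B) ^ (1 / (j : ℝ)) := by


  classical
  by_cases hlt : ENNReal.ofReal δ * μ B ≤ μ B'
  · exact Or.inl hlt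
  right
  push Not at hlt
  have hk : 0 < k := lt_of_lt_of_le hj hjk
  have hkr : (0 : ℝ) < k := by exact_mod_cast hk
  have hjr : (0 : ℝ) < j := by exact_mod_cast hj
  have hB0' : 0 < μ.real B := ENNReal.toReal_pos hB0.ne' (measure_ne_top _ _)
  have hlt' : μ.real B' < δ * μ.real B := by
    have := (ENNReal.toReal_lt_toReal (measure_ne_top _ _)
      (ENNReal.mul_ne_top ENNReal.ofReal_ne_top (measure_ne_top _ _))).2 hlt
    rwa [ENNReal.toReal_mul, ENNReal.toReal_ofReal hδ0.le] at this
  have hdiff : μ.real (B \ B') = μ.real B - μ.real B' := measureReal_sdiff hB' hB'meas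
  have hd1 : (1 - δ) * μ.real B < μ.real (B \ B') := by rw [hdiff]; linarith
  have hd0 : 0 < μ.real (B \ B') := lt_trans (mul_pos (by linarith) hB0') hd1
  rcases A.eq_empty_or_nonempty with rfl | hAne
  · refine ⟨B, hB, hB', subset_rfl, (ENNReal.toReal_pos_iff.1 hd0).1, ?_⟩
    have : ((∅ : Set G) ^ k) • B = ∅ := by
      rw [Set.empty_pow hk.ne', Set.empty_smul]
    rw [this]
    simp [hk]
  lift A to Finset G using hA
  have hpos : ∀ Z : Set X, MeasurableSet Z → ∀ i : ℕ, μ.real Z ≤ μ.real (((A : Set G) ^ i) • Z) := by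
    intro Z hZ i
    obtain ⟨g, hg⟩ := hAne.pow (n := i)
    have : μ.real Z = μ.real (g • Z) := by rw [measureReal_def, measureReal_def, hinv g Z hZ]
    rw [this]
    exact measureReal_mono (Set.smul_set_subset_smul hg) (measure_ne_top _ _)
  have hP : 0 < μ.real (((A : Set G) ^ j) • B) := lt_of_lt_of_le hB0' (hpos B hB j)
  set R := ENNReal.ofReal ((1 - δ) ^ (-(1 / (j : ℝ)))) *
        (μ (((A : Set G) ^ j) • B) / μ B) ^ (1 / (j : ℝ)) with hR
  have hRtop : R ≠ ⊤ := by
    refine ENNReal.mul_ne_top ENNReal.ofReal_ne_top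
      (ENNReal.rpow_ne_top_of_nonneg (by positivity) (ENNReal.div_ne_top (measure_ne_top _ _) hB0.ne'))
  have h1δ : 0 < 1 - δ := by linarith
  have hM : R.toReal = (1 - δ) ^ (-(1 / (j : ℝ))) *
      (μ.real (((A : Set G) ^ j) • B) / μ.real B) ^ (1 / (j : ℝ)) := by
    rw [hR, ENNReal.toReal_mul, ENNReal.toReal_ofReal (by positivity), ← ENNReal.toReal_rpow,
      ENNReal.toReal_div]
    rfl
  have hM0 : 0 < R.toReal := by rw [hM]; positivity
  have hMj : R.toReal ^ j = (1 - δ)⁻¹ * (μ.real (((A : Set G) ^ j) • B) / μ.real B) := by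
    rw [hM, mul_pow, ← Real.rpow_natCast, ← Real.rpow_natCast, ← Real.rpow_mul h1δ.le,
      ← Real.rpow_mul (by positivity), neg_mul, one_div_mul_cancel hjr.ne', Real.rpow_one,
      Real.rpow_neg_one]
  -- reformulation of the inequality
  have hiff : ∀ Z : Set X, 0 < μ Z → ((μ (((A : Set G) ^ k) • Z) / μ Z) ^ (1 / (k : ℝ)) ≤ R ↔
      μ.real (((A : Set G) ^ k) • Z) ≤ R.toReal ^ k * μ.real Z) := by
    intro Z hZ
    rw [one_div, ENNReal.rpow_inv_le_iff hkr, ENNReal.rpow_natCast,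
      ENNReal.div_le_iff hZ.ne' (measure_ne_top _ _), ← ENNReal.toReal_le_toReal
      (measure_ne_top _ _) (ENNReal.mul_ne_top (ENNReal.pow_ne_top hRtop) (measure_ne_top _ _)),
      ENNReal.toReal_mul, ENNReal.toReal_pow]
    rfl
  have hex : ∃ Z ⊆ B \ B', MeasurableSet Z ∧
      μ.real (((A : Set G) ^ k) • Z) < R.toReal ^ k * μ.real Z := by
    by_contra hcon
    push Not at hcon
    have := HeavySet.pluennecke μ hmeas hinv A (B \ B') (hB.diff hB'meas) R.toReal hM0 j k hj hjk hcon
    have h2 : μ.real (((A : Set G) ^ j) • (B \ B')) ≤ μ.real (((A : Set G) ^ j) • B) :=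
      measureReal_mono (Set.smul_subset_smul_left Set.sdiff_subset) (measure_ne_top _ _)
    have h3 := this.trans h2
    have h4 := mul_lt_mul_of_pos_left hd1 (pow_pos hM0 j)
    have h5 : R.toReal ^ j * ((1 - δ) * μ.real B) = μ.real (((A : Set G) ^ j) • B) := by
      rw [hMj]; field_simp
    linarith
  obtain ⟨Z, hZs, hZm, hZ⟩ := hex
  have hZ0 : 0 < μ.real Z := by
    by_contra h
    have h0 : μ.real Z = 0 := le_antisymm (not_lt.1 h) measureReal_nonneg
    rw [h0, mul_zero] at hZ
    exact absurd hZ (not_lt.2 measureReal_nonneg)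
  have hZdis : Disjoint B' Z := Set.disjoint_left.2 fun x hx hxZ => (hZs hxZ).2 hx
  refine ⟨B' ∪ Z, hB'meas.union hZm, Set.subset_union_left,
    Set.union_subset hB' (hZs.trans Set.sdiff_subset), ?_, ?_⟩
  · rw [Set.union_sdiff_cancel_left hZdis.le_bot]
    exact (ENNReal.toReal_pos_iff.1 hZ0).1
  · rw [hiff _ (hB'0.trans_le (measure_mono Set.subset_union_left))]
    have h1 := (hiff B' hB'0).1 hineq
    rw [measureReal_union hZdis hZm, Set.smul_union, mul_add]
    exact (measureReal_union_le _ _).trans (add_le_add h1 hZ.le)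
end

section
/- Let G be a countable abelian group, B ⊆ G, and let X be the Furstenberg G-system corresponding to B with corresponding clopen set B̃. Then for every G-invariant Borel probability measure μ on X and every finite A_0 ⊆ G, one has d*(A_0 B) ≥ μ(A_0 B̃) ≥ d_*(A_0 B), where A_0 B̃ = ⋃_{a ∈ A_0} a·B̃. -/
open Filter MeasureTheory Pointwise

variable {G : Type*}

/-- A Følner sequence: a sequence of nonempty finite subsets `F n` of `G` such that
`|F n ∩ g • F n| / |F n| → 1` for every `g ∈ G`. -/
def IsFolner [Group G] (F : ℕ → Finset G) : Prop :=
  (∀ n, (F n).Nonempty) ∧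
    ∀ g : G, Filter.Tendsto
      (fun n => ((((F n : Set G)) ∩ (g • (F n : Set G))).ncard : ℝ) / (F n).card)
      Filter.atTop (nhds 1)

/-- The upper Banach density of `A ⊆ G`: the supremum over Følner sequences of the
limsup of `|F n ∩ A| / |F n|`. -/
noncomputable def upperBanachDensity [Group G] (A : Set G) : ℝ :=
  sSup {d : ℝ | ∃ F : ℕ → Finset G, IsFolner F ∧
    d = Filter.limsup (fun n => (((F n : Set G) ∩ A).ncard : ℝ) / (F n).card) Filter.atTop}

/-- The lower Banach density of `A ⊆ G`: the infimum over Følner sequences of the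
liminf of `|F n ∩ A| / |F n|`. -/
noncomputable def lowerBanachDensity [Group G] (A : Set G) : ℝ :=
  sInf {d : ℝ | ∃ F : ℕ → Finset G, IsFolner F ∧
    d = Filter.liminf (fun n => (((F n : Set G) ∩ A).ncard : ℝ) / (F n).card) Filter.atTop}

/-- The shift action of `g ∈ G` on `{0,1}^G`: `(g • x) h = x (g h)`. -/
def shiftMap [Group G] (g : G) : (G → Bool) → (G → Bool) := fun x h => x (g * h)

open Classical in
/-- The indicator point `z ∈ {0,1}^G` of `B ⊆ G`: `z g = 1` iff `g ∈ B`. -/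
noncomputable def indicatorPoint (B : Set G) : G → Bool := fun g => decide (g ∈ B)

/-- The Furstenberg `G`-system corresponding to `B ⊆ G`: the closure in `{0,1}^G` of the
orbit of the indicator point of `B` under the shift action. -/
def furstenbergSystem [Group G] (B : Set G) : Set (G → Bool) :=
  closure {x | ∃ g : G, x = shiftMap g (indicatorPoint B)}

/-- The clopen set corresponding to `B`: `B̃ = {x ∈ X | x 1 = 1}`. -/
def furstenbergClopen [Group G] (B : Set G) : Set (G → Bool) :=
  {x | x ∈ furstenbergSystem B ∧ x 1 = true}


theorem exists_folner_set [CommGroup G] (T : Finset G) (ε : ℝ) (hε : 0 < ε) :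
    ∃ F : Finset G, F.Nonempty ∧ ∀ g ∈ T,
      (1 - ε) * (F.card : ℝ) ≤ (((F : Set G) ∩ (g • (F : Set G))).ncard : ℝ) := by
  classical
  let S : ℕ → Finset G := fun N =>
    (Fintype.piFinset (fun _ : T => Finset.range (N + 1))).image
      (fun k => ∏ i : T, (i : G) ^ (k i))
  have hmono : ∀ N, S N ⊆ S (N + 1) := by
    intro N
    apply Finset.image_subset_image
    intro k hk
    simp only [Fintype.mem_piFinset, Finset.mem_range] at hk ⊢
    intro a
    have := hk a
    omega
  have hsm : ∀ N, ∀ g ∈ T, g • S N ⊆ S (N + 1) := by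
    intro N g hg x hx
    rw [Finset.mem_smul_finset] at hx
    obtain ⟨y, hy, rfl⟩ := hx
    obtain ⟨k, hk, rfl⟩ := Finset.mem_image.1 hy
    refine Finset.mem_image.2 ⟨k + Pi.single ⟨g, hg⟩ 1, ?_, ?_⟩
    · simp only [Fintype.mem_piFinset, Finset.mem_range] at hk ⊢
      intro a
      have := hk a
      by_cases h : a = ⟨g, hg⟩
      · subst h; simp; omega
      · simp [h]; omega
    · simp only [Pi.add_apply, pow_add, Finset.prod_mul_distrib, smul_eq_mul]
      rw [mul_comm]
      congr 1
      rw [Finset.prod_eq_single ⟨g, hg⟩]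
      · simp
      · intro b _ hb
        simp [hb]
      · simp
  have hne : ∀ N, (S N).Nonempty := by
    intro N
    exact ⟨_, Finset.mem_image_of_mem _ (a := fun _ => 0) (by simp)⟩
  have hcard : ∀ N, ((S N).card : ℝ) ≤ ((N : ℝ) + 1) ^ T.card := by
    intro N
    have h : (S N).card ≤ (N + 1) ^ T.card := by
      refine Finset.card_image_le.trans ?_
      simp [Fintype.card_piFinset]
    exact_mod_cast h
  have hN : ∃ N, ((S (N + 1)).card : ℝ) ≤ (1 + ε) * (S N).card := by
    by_contra! hcon
    have hgrow : ∀ N, (1 + ε) ^ N ≤ ((S N).card : ℝ) := by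
      intro N
      induction N with
      | zero => simpa using (hne 0)
      | succ n ih =>
        rw [pow_succ, mul_comm]
        refine le_trans ?_ (hcon n).le
        gcongr
    have ht := tendsto_pow_const_div_const_pow_of_one_lt T.card (r := 1 + ε) (by linarith)
    have ht2 := (ht.comp (tendsto_add_atTop_nat 1)).eventually
      (gt_mem_nhds (show (0 : ℝ) < (1 + ε)⁻¹ by positivity))
    obtain ⟨N, hN⟩ := ht2.exists
    simp only [Function.comp] at hN
    rw [div_lt_iff₀ (by positivity), pow_succ] at hN
    have h1 := (hgrow N).trans (hcard N)
    have h2 : (1 + ε)⁻¹ * ((1 + ε) ^ N * (1 + ε)) = (1 + ε) ^ N := by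
      field_simp
    rw [h2] at hN
    push_cast at hN
    linarith
  obtain ⟨N, hN⟩ := hN
  refine ⟨S N, hne N, fun g hg => ?_⟩
  have e : ((S N : Set G) ∩ (g • (S N : Set G))) = ((S N ∩ g • S N : Finset G) : Set G) := by
    simp
  rw [e, Set.ncard_coe_finset]
  have h1 := Finset.card_union_add_card_inter (S N) (g • S N)
  have h2 : (S N ∪ g • S N).card ≤ (S (N + 1)).card :=
    Finset.card_le_card (Finset.union_subset (hmono N) (hsm N g hg))
  rw [Finset.card_smul_finset] at h1
  have h1' : ((S N ∪ g • S N).card : ℝ) + (S N ∩ g • S N).card = (S N).card + (S N).card := by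
    exact_mod_cast h1
  have h2' : ((S N ∪ g • S N).card : ℝ) ≤ (S (N + 1)).card := by exact_mod_cast h2
  linarith

theorem ratio_le_one (F : Finset G) (A : Set G) :
    (((F : Set G) ∩ A).ncard : ℝ) / F.card ≤ 1 := by
  apply div_le_one_of_le₀ _ (by positivity)
  have := Set.ncard_le_ncard (Set.inter_subset_left : (F : Set G) ∩ A ⊆ F) F.finite_toSet
  rw [Set.ncard_coe_finset] at this
  exact_mod_cast this

theorem exists_folner [CommGroup G] [Countable G] : ∃ F : ℕ → Finset G, IsFolner F := by
  classical
  obtain ⟨e, he⟩ := exists_surjective_nat G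
  choose F hF1 hF2 using fun n : ℕ =>
    exists_folner_set ((Finset.range (n + 1)).image e) (1 / ((n : ℝ) + 1)) (by positivity)
  refine ⟨F, hF1, fun g => ?_⟩
  obtain ⟨m, rfl⟩ := he g
  have hl : Tendsto (fun n : ℕ => 1 - 1 / ((n : ℝ) + 1)) atTop (nhds 1) := by
    simpa using (tendsto_one_div_add_atTop_nhds_zero_nat (𝕜 := ℝ)).const_sub 1
  refine tendsto_of_tendsto_of_tendsto_of_le_of_le' hl tendsto_const_nhds ?_
    (Eventually.of_forall fun n => ratio_le_one _ _)
  filter_upwards [eventually_ge_atTop m] with n hn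
  rw [le_div_iff₀ (by exact_mod_cast (hF1 n).card_pos)]
  exact hF2 n _ (Finset.mem_image_of_mem _ (by simp; omega))

theorem folner_translate [CommGroup G] [DecidableEq G] {F : ℕ → Finset G} (hF : IsFolner F)
    (g : ℕ → G) : IsFolner (fun n => g n • F n) := by
  refine ⟨fun n => (hF.1 n).smul_finset, fun h => ?_⟩
  refine (hF.2 h).congr fun n => ?_
  rw [Finset.card_smul_finset, Finset.coe_smul_finset, smul_comm h (g n), ← Set.smul_set_inter,
    Set.ncard_smul_set]

open Classical in
/-- Number of `f ∈ F` with `f • x` in the union of cylinders. -/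
noncomputable def cnt [CommGroup G] (A₀ : Set G) (F : Finset G) (x : G → Bool) : ℝ :=
  ((F.filter (fun f => ∃ a ∈ A₀, x (f * a⁻¹) = true)).card : ℝ)

theorem cnt_transfer [CommGroup G] [DecidableEq G] (B A₀ : Set G) (hA₀ : A₀.Finite) (F : Finset G)
    (x : G → Bool) (hx : x ∈ furstenbergSystem B) :
    ∃ g : G, ((((g • F : Finset G) : Set G) ∩ (A₀ * B)).ncard : ℝ) = cnt A₀ F x := by
  classical
  have hW : IsOpen {y : G → Bool | ∀ f ∈ F, ∀ a ∈ A₀, y (f * a⁻¹) = x (f * a⁻¹)} := by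
    simp only [Set.ofPred_forall]
    refine isOpen_biInter_finset fun f _ => hA₀.isOpen_biInter fun a _ => ?_
    have hc : Continuous fun y : G → Bool => y (f * a⁻¹) := continuous_apply _
    exact (isOpen_discrete ({x (f * a⁻¹)} : Set Bool)).preimage hc
  obtain ⟨y, hy, g, rfl⟩ := mem_closure_iff.1 hx _ hW (fun _ _ _ _ => rfl)
  refine ⟨g, ?_⟩
  have key : (((g • F : Finset G) : Set G) ∩ (A₀ * B)) =
      g • ((F.filter (fun f => ∃ a ∈ A₀, x (f * a⁻¹) = true) : Finset G) : Set G) := by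
    ext u
    rw [Finset.coe_smul_finset, Set.mem_inter_iff, Set.mem_smul_set_iff_inv_smul_mem,
      Set.mem_smul_set_iff_inv_smul_mem]
    simp only [Finset.mem_coe, Finset.mem_filter, smul_eq_mul]
    refine and_congr_right fun hu => ?_
    have h : ∀ a ∈ A₀, (x (g⁻¹ * u * a⁻¹) = true ↔ a⁻¹ * u ∈ B) := by
      intro a ha
      rw [← hy _ hu a ha]
      simp [shiftMap, indicatorPoint, mul_assoc, mul_comm u]
    constructor
    · rintro ⟨a, ha, b, hb, rfl⟩
      exact ⟨a, ha, (h a ha).2 (by simpa using hb)⟩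
    · rintro ⟨a, ha, h'⟩
      exact ⟨a, ha, _, (h a ha).1 h', by simp⟩
  rw [key, Set.ncard_smul_set, Set.ncard_coe_finset, cnt]

theorem shift_image [CommGroup G] (g : G) (S : Set (G → Bool)) :
    shiftMap g '' S = shiftMap g⁻¹ ⁻¹' S := by
  ext y
  constructor
  · rintro ⟨x, hx, rfl⟩
    have : shiftMap g⁻¹ (shiftMap g x) = x := by funext h; simp [shiftMap]
    simpa [this] using hx
  · intro h
    exact ⟨_, h, by funext h; simp [shiftMap]⟩

theorem continuous_shift [Group G] (g : G) : Continuous (shiftMap g) :=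
  continuous_pi fun h => continuous_apply (g * h)

theorem shift_mem [CommGroup G] (B : Set G) (g : G) {x : G → Bool} (hx : x ∈ furstenbergSystem B) :
    shiftMap g x ∈ furstenbergSystem B := by
  refine map_mem_closure (continuous_shift g) hx ?_
  rintro _ ⟨k, rfl⟩
  exact ⟨k * g, by funext h; simp [shiftMap, mul_assoc]⟩

/-- The union of cylinders. -/
def cyl [CommGroup G] (A₀ : Set G) : Set (G → Bool) := {y | ∃ a ∈ A₀, y a⁻¹ = true}

theorem cyl_meas [CommGroup G] (A₀ : Set G) (hA₀ : A₀.Finite) : MeasurableSet (cyl A₀) := by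
  have : cyl A₀ = ⋃ a ∈ A₀, {y : G → Bool | y a⁻¹ = true} := by ext; simp [cyl]
  rw [this]
  exact hA₀.measurableSet_biUnion fun a _ =>
    (measurableSet_singleton true).preimage (measurable_pi_apply a⁻¹)

theorem meas_eq [CommGroup G] [Countable G] (B : Set G)
    (μ : MeasureTheory.Measure (G → Bool)) [MeasureTheory.IsProbabilityMeasure μ]
    (hsupp : μ (furstenbergSystem B) = 1) (A₀ : Set G) :
    μ (⋃ a ∈ A₀, shiftMap a '' furstenbergClopen B) = μ (cyl A₀) := by
  have hX : μ (furstenbergSystem B)ᶜ = 0 :=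
    (prob_compl_eq_zero_iff isClosed_closure.measurableSet).2 hsupp
  have e : (⋃ a ∈ A₀, shiftMap a '' furstenbergClopen B) = cyl A₀ ∩ furstenbergSystem B := by
    ext y
    simp only [shift_image, Set.mem_iUnion, Set.mem_preimage, furstenbergClopen, Set.mem_ofPred_eq,
      cyl, Set.mem_inter_iff]
    constructor
    · rintro ⟨a, ha, h1, h2⟩
      refine ⟨⟨a, ha, by simpa [shiftMap] using h2⟩, ?_⟩
      have : shiftMap a (shiftMap a⁻¹ y) = y := by funext h; simp [shiftMap]
      rw [← this]
      exact shift_mem B a h1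
    · rintro ⟨⟨a, ha, h2⟩, h1⟩
      exact ⟨a, ha, shift_mem B _ h1, by simpa [shiftMap] using h2⟩
  rw [e]
  exact measure_inter_conull hX

theorem cnt_integral [CommGroup G] [Countable G]
    (μ : MeasureTheory.Measure (G → Bool)) [MeasureTheory.IsProbabilityMeasure μ]
    (hinv : ∀ (g : G) (S : Set (G → Bool)), MeasurableSet S →
      μ (shiftMap g '' S) = μ S) (A₀ : Set G) (hA₀ : A₀.Finite) (F : Finset G) :
    Integrable (cnt A₀ F) μ ∧ ∫ x, cnt A₀ F x ∂μ = F.card * (μ (cyl A₀)).toReal := by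
  classical
  have e : cnt A₀ F = fun x => ∑ f ∈ F, (shiftMap f⁻¹ '' cyl A₀).indicator (fun _ => (1 : ℝ)) x := by
    funext x
    simp only [cnt, Finset.card_filter, shift_image, inv_inv]
    push_cast
    refine Finset.sum_congr rfl fun f _ => ?_
    simp [Set.indicator_apply, cyl, shiftMap]
  have hm : ∀ f : G, MeasurableSet (shiftMap f⁻¹ '' cyl A₀) := by
    intro f
    rw [shift_image]
    refine (cyl_meas A₀ hA₀).preimage ?_
    exact measurable_pi_lambda _ fun h => measurable_pi_apply _
  have hi : ∀ f ∈ F, Integrable ((shiftMap f⁻¹ '' cyl A₀).indicator (fun _ => (1 : ℝ))) μ :=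
    fun f _ => (integrable_const 1).indicator (hm f)
  rw [e]
  refine ⟨integrable_finsetSum _ hi, ?_⟩
  rw [integral_finsetSum _ hi]
  have : ∀ f ∈ F, ∫ x, (shiftMap f⁻¹ '' cyl A₀).indicator (fun _ => (1 : ℝ)) x ∂μ
      = (μ (cyl A₀)).toReal := by
    intro f _
    rw [integral_indicator_const _ (hm f), Measure.real, hinv _ _ (cyl_meas A₀ hA₀)]
    simp
  rw [Finset.sum_congr rfl this]
  simp

/-- Let `X` be the Furstenberg system corresponding to `B ⊆ G` with corresponding clopen
set `B̃`. Then for every shift-invariant Borel probability measure `μ` on `X` (i.e. a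
probability measure on `{0,1}^G` carried by `X`) and every finite `A₀ ⊆ G`, one has
`d*(A₀ B) ≥ μ(A₀ B̃) ≥ d_*(A₀ B)`, where `A₀ B̃ = ⋃_{a ∈ A₀} a • B̃`. -/
theorem furstenberg_measure_between_densities [CommGroup G] [Countable G] (B : Set G)
    (μ : MeasureTheory.Measure (G → Bool)) [MeasureTheory.IsProbabilityMeasure μ]
    (hsupp : μ (furstenbergSystem B) = 1)
    (hinv : ∀ (g : G) (S : Set (G → Bool)), MeasurableSet S →
      μ (shiftMap g '' S) = μ S)
    (A₀ : Set G) (hA₀ : A₀.Finite) :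
    upperBanachDensity (A₀ * B) ≥ (μ (⋃ a ∈ A₀, shiftMap a '' furstenbergClopen B)).toReal ∧
      (μ (⋃ a ∈ A₀, shiftMap a '' furstenbergClopen B)).toReal ≥
        lowerBanachDensity (A₀ * B) := by
  classical
  rw [meas_eq B μ hsupp]
  set m := (μ (cyl A₀)).toReal with hm
  have hX : μ (furstenbergSystem B)ᶜ = 0 :=
    (prob_compl_eq_zero_iff isClosed_closure.measurableSet).2 hsupp
  obtain ⟨F, hF⟩ := exists_folner (G := G)
  have hpos : ∀ n, (0 : ℝ) < (F n).card := fun n => by exact_mod_cast (hF.1 n).card_pos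
  have hup : ∀ n, ∃ g : G, m ≤
      ((((g • F n : Finset G) : Set G) ∩ (A₀ * B)).ncard : ℝ) / (g • F n).card := by
    intro n
    obtain ⟨h1, h2⟩ := cnt_integral μ hinv A₀ hA₀ (F n)
    obtain ⟨x, hx, hle⟩ := exists_notMem_null_integral_le h1 hX
    obtain ⟨g, hg⟩ := cnt_transfer B A₀ hA₀ (F n) x (by simpa using hx)
    refine ⟨g, ?_⟩
    rw [hg, Finset.card_smul_finset, le_div_iff₀ (hpos n)]
    linarith
  have hlo : ∀ n, ∃ g : G,
      ((((g • F n : Finset G) : Set G) ∩ (A₀ * B)).ncard : ℝ) / (g • F n).card ≤ m := by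
    intro n
    obtain ⟨h1, h2⟩ := cnt_integral μ hinv A₀ hA₀ (F n)
    obtain ⟨x, hx, hle⟩ := exists_notMem_null_le_integral h1 hX
    obtain ⟨g, hg⟩ := cnt_transfer B A₀ hA₀ (F n) x (by simpa using hx)
    refine ⟨g, ?_⟩
    rw [hg, Finset.card_smul_finset, div_le_iff₀ (hpos n)]
    linarith
  have hbb : ∀ F : ℕ → Finset G, IsBoundedUnder (· ≤ ·) atTop
      (fun n => (((F n : Set G) ∩ (A₀ * B)).ncard : ℝ) / (F n).card) := fun F =>
    isBoundedUnder_of ⟨1, fun n => ratio_le_one _ _⟩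
  have hba : ∀ F : ℕ → Finset G, IsBoundedUnder (· ≥ ·) atTop
      (fun n => (((F n : Set G) ∩ (A₀ * B)).ncard : ℝ) / (F n).card) := fun F =>
    isBoundedUnder_of ⟨0, fun n => by positivity⟩
  constructor
  · choose g hg using hup
    refine le_csSup_of_le ?_ ⟨_, folner_translate hF g, rfl⟩ ?_
    · refine ⟨1, ?_⟩
      rintro _ ⟨F, -, rfl⟩
      exact limsup_le_of_le (hba F).isCoboundedUnder_le
        (Eventually.of_forall fun n => ratio_le_one _ _)
    · exact le_limsup_of_frequently_le (Frequently.of_forall hg) (hbb _)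
  · choose g hg using hlo
    refine csInf_le_of_le ?_ ⟨_, folner_translate hF g, rfl⟩ ?_
    · refine ⟨0, ?_⟩
      rintro _ ⟨F, -, rfl⟩
      exact le_liminf_of_le (hbb F).isCoboundedUnder_ge
        (Eventually.of_forall fun n => by positivity)
    · exact liminf_le_of_frequently_le (Frequently.of_forall hg) (hba _)
end
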